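/- Let d ∈ ℕ and let 𝓘^d denote the set of all lattice-free integral polyhedra P ⊆ ℝ^d (i.e., P has nonempty interior, int(P) ∩ ℤ^d = ∅, and P = conv(P ∩ ℤ^d)) such that P is not properly contained in another lattice-free integral polyhedron. Then there exists a natural number N (depending only on d) and polyhedra P₁, …, P_N ∈ 𝓘^d such that for every P ∈ 𝓘^d one has P = U·P_j + v for some matrix U ∈ ℤ^{d×d} with |det U| = 1, some vector v ∈ ℤ^d, and some j ∈ {1, …, N}. -/

import Mathlib

open Set

/-- The set of integer points `ℤ^d` inside `ℝ^d`. -/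
def intPts (d : ℕ) : Set (Fin d → ℝ) := {x | ∀ i, ∃ z : ℤ, x i = (z : ℝ)}

/-- The lattice `Λ = s·ℤ^d` inside `ℝ^d`. -/
def sLat (d s : ℕ) : Set (Fin d → ℝ) := {x | ∀ i, ∃ z : ℤ, x i = (s : ℝ) * (z : ℝ)}

/-- A polyhedron: a finite intersection of closed halfspaces. -/
def IsPolyhedron {d : ℕ} (P : Set (Fin d → ℝ)) : Prop :=
  ∃ (n : ℕ) (A : Fin n → Fin d → ℝ) (b : Fin n → ℝ),
    P = {x | ∀ i, (∑ j, A i j * x j) ≤ b i}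

/-- An integral set: it equals the convex hull of its integer points. -/
def IsIntegralPoly {d : ℕ} (P : Set (Fin d → ℝ)) : Prop :=
  P = convexHull ℝ (P ∩ intPts d)

/-- The affine map `x ↦ U·x + t` with integer matrix `U` and translation `t : ℝ^d`. -/
noncomputable def affMap {d : ℕ} (U : Matrix (Fin d) (Fin d) ℤ) (t : Fin d → ℝ)
    (x : Fin d → ℝ) : Fin d → ℝ := fun i => (∑ j, (U i j : ℝ) * x j) + t i

/-- A lattice-free integral polyhedron with nonempty interior. -/
def LatFreeIntegral (d : ℕ) (P : Set (Fin d → ℝ)) : Prop :=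
  IsPolyhedron P ∧ (interior P).Nonempty ∧ interior P ∩ intPts d = ∅ ∧ IsIntegralPoly P

/-- Membership in `𝓘^d`: a lattice-free integral polyhedron which is not properly
contained in another lattice-free integral polyhedron. -/
def MemI (d : ℕ) (P : Set (Fin d → ℝ)) : Prop :=
  LatFreeIntegral d P ∧ ∀ Q : Set (Fin d → ℝ), LatFreeIntegral d Q → P ⊆ Q → P = Q

open Filter Topology

section ClosedSubgroups

variable {E : Type*} [NormedAddCommGroup E] [NormedSpace ℝ E]

/-- The largest linear subspace contained in an additive subgroup. -/
def linealitySpace (G : AddSubgroup E) : Submodule ℝ E where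
  carrier := {v | ∀ t : ℝ, t • v ∈ G}
  add_mem' ha hb t := by rw [smul_add]; exact G.add_mem (ha t) (hb t)
  zero_mem' t := by rw [smul_zero]; exact G.zero_mem
  smul_mem' c v hv t := by rw [smul_smul]; exact hv _

theorem mem_of_mem_linealitySpace {G : AddSubgroup E} {v : E} (hv : v ∈ linealitySpace G) :
    v ∈ G := by
  simpa using hv 1

theorem exists_ne_zero_mem_linealitySpace [FiniteDimensional ℝ E] {G : AddSubgroup E}
    (hG : IsClosed (G : Set E)) (h : ∀ ε > 0, ∃ g ∈ G, g ≠ 0 ∧ ‖g‖ < ε) :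
    ∃ u ∈ linealitySpace G, u ≠ 0 := by
  have h' : ∀ n : ℕ, ∃ g ∈ G, g ≠ 0 ∧ ‖g‖ < 1 / ((n : ℝ) + 1) :=
    fun n => h _ Nat.one_div_pos_of_nat
  choose g hgG hg0 hgn using h'
  have hpos : ∀ n, 0 < ‖g n‖ := fun n => norm_pos_iff.2 (hg0 n)
  have hg : Tendsto (fun n => ‖g n‖) atTop (𝓝 0) :=
    squeeze_zero (fun n => norm_nonneg _) (fun n => (hgn n).le)
      tendsto_one_div_add_atTop_nhds_zero_nat
  obtain ⟨u, hu, φ, hφ, hlim⟩ := (isCompact_sphere (0 : E) 1).tendsto_subseq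
    (x := fun n => ‖g n‖⁻¹ • g n) (fun n => by
      simp [norm_smul, (hpos n).ne'])
  refine ⟨u, fun t => ?_, fun h => by simp [h] at hu⟩
  have hgφ := hg.comp hφ.tendsto_atTop
  have hcoef : Tendsto (fun n => (⌊t / ‖g (φ n)‖⌋ : ℝ) * ‖g (φ n)‖) atTop (𝓝 t) := by
    rw [tendsto_iff_dist_tendsto_zero]
    refine squeeze_zero (fun n => dist_nonneg) (fun n => ?_) hgφ
    have h1 := Int.floor_le (t / ‖g (φ n)‖)
    have h2 := Int.lt_floor_add_one (t / ‖g (φ n)‖)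
    rw [le_div_iff₀ (hpos _)] at h1
    rw [div_lt_iff₀ (hpos _)] at h2
    rw [Real.dist_eq, abs_le]
    simp only [Function.comp]
    constructor <;> nlinarith [hpos (φ n)]
  have hT := hcoef.smul hlim
  refine hG.mem_of_tendsto hT (Eventually.of_forall fun n => ?_)
  have : ((⌊t / ‖g (φ n)‖⌋ : ℝ) * ‖g (φ n)‖) • (‖g (φ n)‖⁻¹ • g (φ n))
      = ⌊t / ‖g (φ n)‖⌋ • g (φ n) := by
    rw [smul_smul, mul_assoc, mul_inv_cancel₀ (hpos _).ne', mul_one, Int.cast_smul_eq_zsmul]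
  simp only [Function.comp, SetLike.mem_coe]
  rw [this]
  exact G.zsmul_mem (hgG _) _

/-- A projection along the lineality space, together with a norm bound. -/
theorem exists_proj_linealitySpace [FiniteDimensional ℝ E] (G : AddSubgroup E) :
    ∃ (p : E →ₗ[ℝ] E) (C : ℝ), 1 ≤ C ∧ (∀ x, ‖p x‖ ≤ C * ‖x‖) ∧
      (∀ x, p (p x) = p x) ∧ (∀ x, p x = 0 ↔ x ∈ linealitySpace G) ∧
      (∀ x, x - p x ∈ linealitySpace G) := by
  obtain ⟨W, hW⟩ := (linealitySpace G).exists_isCompl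
  let p : E →ₗ[ℝ] E := W.subtype ∘ₗ W.projectionOnto (linealitySpace G) hW.symm
  have hker : ∀ x, p x = 0 ↔ x ∈ linealitySpace G := fun x => by simp [p]
  have hpp : ∀ x, p (p x) = p x := fun x => by simp [p]
  refine ⟨p, max 1 ‖LinearMap.toContinuousLinearMap p‖, le_max_left _ _, fun x => ?_, hpp, hker,
    fun x => ?_⟩
  · refine ((LinearMap.toContinuousLinearMap p).le_opNorm x).trans ?_
    exact mul_le_mul_of_nonneg_right (le_max_right _ _) (norm_nonneg _)
  · rw [← hker, map_sub, hpp, sub_self]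

theorem exists_small_mem_linealitySpace [FiniteDimensional ℝ E] {G : AddSubgroup E}
    (hG : IsClosed (G : Set E)) :
    ∃ ε > 0, ∀ g ∈ G, ‖g‖ < ε → g ∈ linealitySpace G := by
  by_contra! hcon
  obtain ⟨p, C, hC, hpC, hpp, hker, hsub⟩ := exists_proj_linealitySpace G
  let W : Submodule ℝ E := LinearMap.range p
  have hcl : IsClosed ((G ⊓ W.toAddSubgroup : AddSubgroup E) : Set E) :=
    hG.inter W.closed_of_finiteDimensional
  obtain ⟨u, hu, hu0⟩ := exists_ne_zero_mem_linealitySpace hcl (fun ε hε => by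
    obtain ⟨g, hg, hgε, hgV⟩ := hcon (ε / C) (by positivity)
    refine ⟨p g, ⟨?_, LinearMap.mem_range_self p g⟩, fun h => hgV ((hker g).1 h), ?_⟩
    · have := G.sub_mem hg (mem_of_mem_linealitySpace (hsub g))
      simpa using this
    · calc ‖p g‖ ≤ C * ‖g‖ := hpC g
        _ < C * (ε / C) := by gcongr
        _ = ε := by field_simp)
  have huG : u ∈ linealitySpace G := fun t => (hu t).1
  obtain ⟨y, hy⟩ := (mem_of_mem_linealitySpace hu).2
  apply hu0
  rw [← hy, ← hpp, hy, (hker u).2 huG]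

/-- The quotient by a closed subgroup has no small subgroups. -/
theorem exists_mem_of_forall_nsmul_near [FiniteDimensional ℝ E] {G : AddSubgroup E}
    (hG : IsClosed (G : Set E)) :
    ∃ δ > 0, ∀ x, (∀ k : ℕ, ∃ l ∈ G, ‖k • x - l‖ < δ) → x ∈ G := by
  obtain ⟨ε, hε, hsmall⟩ := exists_small_mem_linealitySpace hG
  obtain ⟨p, C, hC, hpC, hpp, hker, hsub⟩ := exists_proj_linealitySpace G
  have hC0 : 0 < C := by linarith
  set δ := ε / (4 * C) with hδ
  have hδ0 : 0 < δ := by positivity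
  have hCδ : 4 * (C * δ) = ε := by rw [hδ]; field_simp
  refine ⟨δ, hδ0, fun x hx => ?_⟩
  obtain ⟨l, hl, hxl⟩ := hx 1
  rw [one_smul] at hxl
  set w := p (x - l) with hw
  have hxw : x - w ∈ G := by
    have := G.add_mem hl (mem_of_mem_linealitySpace (hsub (x - l)))
    convert this using 1
    rw [hw]; abel
  have hnear : ∀ k : ℕ, ∃ m ∈ G, ‖k • w - m‖ < δ := fun k => by
    obtain ⟨m, hm, hkm⟩ := hx k
    refine ⟨m - k • (x - w), G.sub_mem hm (G.nsmul_mem hxw k), ?_⟩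
    convert hkm using 2
    rw [smul_sub]; abel
  have hbound : ∀ k : ℕ, ‖k • w‖ ≤ C * δ := by
    intro k
    induction k with
    | zero => simp; positivity
    | succ k ih =>
      have h1 : ‖w‖ ≤ C * δ := (hpC _).trans (by gcongr)
      have h2 : ‖(k + 1) • w‖ ≤ 2 * (C * δ) := by
        rw [succ_nsmul]
        exact (norm_add_le _ _).trans (by linarith)
      obtain ⟨m, hm, hkm⟩ := hnear (k + 1)
      have h3 : ‖m‖ < ε := by
        have : ‖m‖ ≤ ‖(k + 1) • w‖ + ‖(k + 1) • w - m‖ := by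
          rw [← norm_neg ((k + 1) • w - m)]
          calc ‖m‖ = ‖(k + 1) • w + -((k + 1) • w - m)‖ := by congr 1; abel
            _ ≤ _ := norm_add_le _ _
        nlinarith
      have h4 : p m = 0 := (hker m).2 (hsmall m hm h3)
      have h5 : (k + 1) • w = p ((k + 1) • w - m) := by
        rw [map_sub, h4, map_nsmul, hw, hpp, sub_zero]
      rw [h5]
      exact (hpC _).trans (by gcongr)
  have hw0 : w = 0 := by
    by_contra hne
    have hpos : 0 < ‖w‖ := norm_pos_iff.2 hne
    obtain ⟨k, hk⟩ := exists_nat_gt (C * δ / ‖w‖)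
    rw [div_lt_iff₀ hpos] at hk
    have := hbound k
    rw [← Nat.cast_smul_eq_nsmul ℝ, norm_smul, Real.norm_natCast] at this
    linarith
  simpa [hw0] using hxw

end ClosedSubgroups

/-- The lattice `ℤ^d` as an additive subgroup of `ℝ^d`. -/
def intLattice (d : ℕ) : AddSubgroup (Fin d → ℝ) where
  carrier := intPts d
  add_mem' := by
    intro a b ha hb i
    obtain ⟨m, hm⟩ := ha i
    obtain ⟨n, hn⟩ := hb i
    exact ⟨m + n, by simp [hm, hn]⟩
  zero_mem' i := ⟨0, by simp⟩
  neg_mem' := by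
    intro a ha i
    obtain ⟨m, hm⟩ := ha i
    exact ⟨-m, by simp [hm]⟩

theorem intCast_mem_intLattice {d : ℕ} (z : Fin d → ℤ) :
    (fun i => (z i : ℝ)) ∈ intLattice d := fun i => ⟨z i, rfl⟩

theorem exists_intCast_eq {d : ℕ} {x : Fin d → ℝ} (hx : x ∈ intPts d) :
    ∃ z : Fin d → ℤ, x = fun i => (z i : ℝ) := by
  choose z hz using hx
  exact ⟨z, funext hz⟩

theorem single_mem_intLattice {d : ℕ} (i : Fin d) :
    (Pi.single i 1 : Fin d → ℝ) ∈ intLattice d := by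
  intro j
  by_cases h : j = i
  · subst h; exact ⟨1, by simp⟩
  · exact ⟨0, by simp [h]⟩

theorem exists_sub_mem_intLattice {d : ℕ} (x : Fin d → ℝ) :
    ∃ z ∈ intLattice d, ‖x - z‖ ≤ 1 := by
  refine ⟨fun i => ((⌊x i⌋ : ℤ) : ℝ), intCast_mem_intLattice _, ?_⟩
  rw [pi_norm_le_iff_of_nonneg zero_le_one]
  intro i
  rw [Pi.sub_apply, Real.norm_eq_abs, abs_le]
  constructor <;> linarith [Int.floor_le (x i), Int.lt_floor_add_one (x i)]

theorem finite_intLattice_inter {d : ℕ} {B : Set (Fin d → ℝ)} (hB : Bornology.IsBounded B) :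
    (B ∩ intPts d).Finite := by
  obtain ⟨R, hR⟩ := hB.subset_closedBall 0
  have hfin : (Set.pi univ fun _ : Fin d => Icc (-⌈R⌉) ⌈R⌉).Finite :=
    Set.Finite.pi' (fun _ => finite_Icc _ _) |>.subset (by intro z hz i; exact hz i trivial)
  refine (hfin.image fun z : Fin d → ℤ => fun i => (z i : ℝ)).subset ?_
  rintro x ⟨hxB, hx⟩
  obtain ⟨z, rfl⟩ := exists_intCast_eq hx
  refine ⟨z, fun i _ => ?_, rfl⟩
  have h1 : ‖((z i : ℤ) : ℝ)‖ ≤ R :=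
    (norm_le_pi_norm (fun i => (z i : ℝ)) i).trans (by simpa using hR hxB)
  rw [Real.norm_eq_abs, abs_le] at h1
  have h2 := Int.le_ceil R
  constructor
  · have : ((-⌈R⌉ : ℤ) : ℝ) ≤ z i := by push_cast; linarith
    exact_mod_cast this
  · have : (z i : ℝ) ≤ (⌈R⌉ : ℤ) := by linarith
    exact_mod_cast this

/-- Simultaneous Diophantine approximation with a uniform bound on the multiplier. -/
theorem exists_bound_nsmul_near_intLattice (d : ℕ) {ε : ℝ} (hε : 0 < ε) :
    ∃ N : ℕ, ∀ x : Fin d → ℝ, ∃ k : ℕ, 0 < k ∧ k ≤ N ∧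
      ∃ z ∈ intLattice d, ‖k • x - z‖ < ε := by
  obtain ⟨t, -, htf, htc⟩ := (isCompact_closedBall (0 : Fin d → ℝ) 1).finite_cover_balls
    (half_pos hε)
  lift t to Finset (Fin d → ℝ) using htf
  refine ⟨t.card, fun x => ?_⟩
  choose z hz hzn using fun k : ℕ => exists_sub_mem_intLattice (k • x)
  have hc : ∀ k : ℕ, ∃ c ∈ t, ‖k • x - z k - c‖ < ε / 2 := fun k => by
    have := htc (show k • x - z k ∈ Metric.closedBall 0 1 by simpa using hzn k)
    simpa [dist_eq_norm] using this
  choose c hct hcn using hc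
  obtain ⟨i, hi, j, hj, hij, hcij⟩ := Finset.exists_ne_map_eq_of_card_lt_of_maps_to
    (s := Finset.range (t.card + 1)) (t := t) (f := c) (by simp) (fun k _ => hct k)
  have key : ∀ i j : ℕ, i < j → j ≤ t.card → c i = c j → ∃ k : ℕ, 0 < k ∧ k ≤ t.card ∧
      ∃ z ∈ intLattice d, ‖k • x - z‖ < ε := by
    intro i j hij hj hcij
    refine ⟨j - i, by omega, by omega, z j - z i, (intLattice d).sub_mem (hz j) (hz i), ?_⟩
    have h1 : (j - i) • x - (z j - z i) = (j • x - z j - c j) - (i • x - z i - c i) := by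
      have : j • x = (j - i) • x + i • x := by rw [← add_smul]; congr 1; omega
      rw [this, hcij]; abel
    rw [h1]
    linarith [norm_sub_le (j • x - z j - c j) (i • x - z i - c i), hcn i, hcn j]
  simp only [Finset.mem_range] at hi hj
  rcases lt_or_gt_of_ne hij with h | h
  · exact key i j h (by omega) hcij
  · exact key j i h (by omega) hcij.symm

theorem exists_intLattice_mem_linealitySpace {d : ℕ} {G : AddSubgroup (Fin d → ℝ)}
    (hG : IsClosed (G : Set (Fin d → ℝ))) (hZ : intLattice d ≤ G)
    (h : ∀ ε > 0, ∃ g ∈ G, g ≠ 0 ∧ ‖g‖ < ε) :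
    ∃ r ∈ intLattice d, r ≠ 0 ∧ r ∈ linealitySpace G := by
  obtain ⟨u, hu, hu0⟩ := exists_ne_zero_mem_linealitySpace hG h
  obtain ⟨ε, hε, hsmall⟩ := exists_small_mem_linealitySpace hG
  obtain ⟨N, hN⟩ := exists_bound_nsmul_near_intLattice d (lt_min hε one_pos)
  obtain ⟨k, hk, -, z, hz, hkz⟩ := hN (‖u‖⁻¹ • u)
  set w := ‖u‖⁻¹ • u with hw
  have hwV : w ∈ linealitySpace G := Submodule.smul_mem _ _ hu
  have hw1 : ‖w‖ = 1 := by simp [hw, norm_smul, hu0]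
  have hkV : k • w ∈ linealitySpace G := Submodule.smul_of_tower_mem _ k hwV
  refine ⟨z, hz, ?_, ?_⟩
  · rintro rfl
    have h1 : ‖k • w‖ < 1 := by simpa using hkz.trans_le (min_le_right _ _)
    rw [← Nat.cast_smul_eq_nsmul ℝ, norm_smul, hw1, Real.norm_natCast] at h1
    have : (1 : ℝ) ≤ k := by exact_mod_cast hk
    linarith
  · have h2 := hsmall _ (G.sub_mem (mem_of_mem_linealitySpace hkV) (hZ hz))
      (hkz.trans_le (min_le_left _ _))
    simpa using Submodule.sub_mem _ hkV h2

section Cylinders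

variable {E : Type*} [NormedAddCommGroup E] [NormedSpace ℝ E]

/-- The Minkowski sum of a set and a linear subspace. -/
def cylinder (V : Submodule ℝ E) (C : Set E) : Set E := {x | ∃ v ∈ V, x + v ∈ C}

theorem subset_cylinder (V : Submodule ℝ E) (C : Set E) : C ⊆ cylinder V C :=
  fun x hx => ⟨0, V.zero_mem, by simpa using hx⟩

theorem cylinder_mono {V W : Submodule ℝ E} {C D : Set E} (hVW : V ≤ W)
    (hCD : C ⊆ cylinder W D) : cylinder V C ⊆ cylinder W D := by
  rintro x ⟨v, hv, hx⟩
  obtain ⟨w, hw, hxw⟩ := hCD hx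
  exact ⟨v + w, W.add_mem (hVW hv) hw, by rwa [← add_assoc]⟩

theorem convex_cylinder {C : Set E} (hC : Convex ℝ C) (V : Submodule ℝ E) :
    Convex ℝ (cylinder V C) := by
  rintro x ⟨v, hv, hx⟩ y ⟨w, hw, hy⟩ a b ha hb hab
  refine ⟨a • v + b • w, V.add_mem (V.smul_mem _ hv) (V.smul_mem _ hw), ?_⟩
  convert hC hx hy ha hb hab using 1
  module

theorem interior_cylinder_subset {C : Set E} (hC : Convex ℝ C)
    (hne : (interior C).Nonempty) (V : Submodule ℝ E) :
    interior (cylinder V C) ⊆ cylinder V (interior C) := by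
  intro y hy
  obtain ⟨c₀, hc₀⟩ := hne
  have hlim : Tendsto (fun s : ℝ => y + s • (y - c₀)) (𝓝[>] 0) (𝓝 y) := by
    have : Continuous fun s : ℝ => y + s • (y - c₀) := by fun_prop
    simpa using (this.tendsto 0).mono_left nhdsWithin_le_nhds
  obtain ⟨s, ⟨v, hv, hs⟩, hs0⟩ :=
    ((hlim.eventually (mem_interior_iff_mem_nhds.1 hy)).and self_mem_nhdsWithin).exists
  have hs0 : (0 : ℝ) < s := hs0
  refine ⟨(1 / (1 + s)) • v, V.smul_mem _ hv, ?_⟩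
  have := hC.combo_interior_self_mem_interior hc₀ hs (a := s / (1 + s)) (b := 1 / (1 + s))
    (by positivity) (by positivity) (by field_simp; ring)
  convert this using 1
  have h1 : (1 + s) ≠ 0 := by positivity
  match_scalars <;> field_simp
  ring

end Cylinders

section UltraLimits

variable {E : Type*} [NormedAddCommGroup E]

/-- The set of limits along an ultrafilter of sequences selected from a sequence of sets. -/
def ultraLim (𝒰 : Ultrafilter ℕ) (A : ℕ → Set E) : Set E :=
  {x | ∃ f : ℕ → E, (∀ᶠ n in 𝒰, f n ∈ A n) ∧ Tendsto f 𝒰 (𝓝 x)}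

theorem subset_ultraLim (𝒰 : Ultrafilter ℕ) {A : ℕ → Set E} {K : Set E} (h : ∀ n, K ⊆ A n) :
    K ⊆ ultraLim 𝒰 A :=
  fun x hx => ⟨fun _ => x, Eventually.of_forall fun n => h n hx, tendsto_const_nhds⟩

theorem isClosed_ultraLim {𝒰 : Ultrafilter ℕ} (h𝒰 : (𝒰 : Filter ℕ) ≤ atTop) {A : ℕ → Set E}
    (hA : ∀ n, (A n).Nonempty) : IsClosed (ultraLim 𝒰 A) := by
  refine isClosed_of_closure_subset fun x hx => ?_
  have hnear : ∀ ε > 0, ∀ᶠ n in 𝒰, Metric.infDist x (A n) < ε := by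
    intro ε hε
    obtain ⟨y, ⟨f, hf, hfy⟩, hxy⟩ := Metric.mem_closure_iff.1 hx (ε / 2) (half_pos hε)
    filter_upwards [hf, hfy.eventually (Metric.ball_mem_nhds y (half_pos hε))] with n hn hn'
    refine (Metric.infDist_lt_iff (hA n)).2 ⟨f n, hn, ?_⟩
    have := dist_triangle x y (f n)
    rw [dist_comm] at hn'
    linarith
  have hex : ∀ n : ℕ, ∃ y ∈ A n, dist x y < Metric.infDist x (A n) + 1 / ((n : ℝ) + 1) :=
    fun n => (Metric.infDist_lt_iff (hA n)).1 (lt_add_of_pos_right _ Nat.one_div_pos_of_nat)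
  choose f hf hfx using hex
  refine ⟨f, Eventually.of_forall hf, Metric.tendsto_nhds.2 fun ε hε => ?_⟩
  have h1 : ∀ᶠ n : ℕ in 𝒰, 1 / ((n : ℝ) + 1) < ε / 2 :=
    (tendsto_one_div_add_atTop_nhds_zero_nat.mono_left h𝒰).eventually
      (gt_mem_nhds (half_pos hε))
  filter_upwards [hnear _ (half_pos hε), h1] with n hn hn'
  rw [dist_comm]
  linarith [hfx n]

/-- The limit of a sequence of additive subgroups along an ultrafilter. -/
def ultraLimSubgroup (𝒰 : Ultrafilter ℕ) (L : ℕ → AddSubgroup E) : AddSubgroup E where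
  carrier := ultraLim 𝒰 fun n => (L n : Set E)
  add_mem' := by
    rintro x y ⟨f, hf, hfx⟩ ⟨g, hg, hgy⟩
    exact ⟨fun n => f n + g n, (hf.and hg).mono fun n hn => (L n).add_mem hn.1 hn.2,
      hfx.add hgy⟩
  zero_mem' := ⟨fun _ => 0, Eventually.of_forall fun n => (L n).zero_mem, tendsto_const_nhds⟩
  neg_mem' := by
    rintro x ⟨f, hf, hfx⟩
    exact ⟨fun n => -f n, hf.mono fun n hn => (L n).neg_mem hn, hfx.neg⟩

theorem isClosed_ultraLimSubgroup {𝒰 : Ultrafilter ℕ} (h𝒰 : (𝒰 : Filter ℕ) ≤ atTop)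
    (L : ℕ → AddSubgroup E) : IsClosed (ultraLimSubgroup 𝒰 L : Set E) :=
  isClosed_ultraLim h𝒰 fun n => ⟨0, (L n).zero_mem⟩

variable [NormedSpace ℝ E]

theorem convex_ultraLim (𝒰 : Ultrafilter ℕ) {A : ℕ → Set E} (h : ∀ n, Convex ℝ (A n)) :
    Convex ℝ (ultraLim 𝒰 A) := by
  rintro x ⟨f, hf, hfx⟩ y ⟨g, hg, hgy⟩ a b ha hb hab
  exact ⟨fun n => a • f n + b • g n, (hf.and hg).mono fun n hn => h n hn.1 hn.2 ha hb hab,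
    (hfx.const_smul a).add (hgy.const_smul b)⟩

theorem exists_ultraLim_of_bounded [FiniteDimensional ℝ E] {𝒰 : Ultrafilter ℕ}
    {Q : ℕ → E → Prop} {R : ℝ} (h : ∀ᶠ n in 𝒰, ∃ y, ‖y‖ ≤ R ∧ Q n y) :
    ∃ (f : ℕ → E) (x : E), (∀ᶠ n in 𝒰, ‖f n‖ ≤ R ∧ Q n (f n)) ∧ Tendsto f 𝒰 (𝓝 x) := by
  have : ProperSpace E := FiniteDimensional.proper ℝ E
  obtain ⟨f, hf⟩ := h.choice
  obtain ⟨x, -, hx⟩ := (isCompact_closedBall (0 : E) R).ultrafilter_le_nhds (𝒰.map f) (by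
    rw [Ultrafilter.coe_map, le_principal_iff, mem_map]
    filter_upwards [hf] with n hn
    simpa using hn.1)
  exact ⟨f, x, hf, hx⟩

theorem exists_small_mem_ultraLimSubgroup [FiniteDimensional ℝ E] {𝒰 : Ultrafilter ℕ}
    (h𝒰 : (𝒰 : Filter ℕ) ≤ atTop) {L : ℕ → AddSubgroup E}
    (h : ∀ n : ℕ, ∃ g ∈ L n, g ≠ 0 ∧ ‖g‖ < 1 / ((n : ℝ) + 1)) {ε : ℝ} (hε : 0 < ε) :
    ∃ g ∈ ultraLimSubgroup 𝒰 L, g ≠ 0 ∧ ‖g‖ < ε := by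
  have h1 : ∀ᶠ n : ℕ in 𝒰, 1 / ((n : ℝ) + 1) < ε / 4 :=
    (tendsto_one_div_add_atTop_nhds_zero_nat.mono_left h𝒰).eventually
      (gt_mem_nhds (by positivity))
  have h2 : ∀ᶠ n in 𝒰, ∃ y, ‖y‖ ≤ ε / 2 ∧ (y ∈ L n ∧ ε / 4 ≤ ‖y‖) := by
    filter_upwards [h1] with n hn
    obtain ⟨g, hg, hg0, hgn⟩ := h n
    have hpos : 0 < ‖g‖ := norm_pos_iff.2 hg0
    have hk1 := Nat.le_ceil (ε / 4 / ‖g‖)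
    have hk2 := Nat.ceil_lt_add_one (a := ε / 4 / ‖g‖) (by positivity)
    set k := ⌈ε / 4 / ‖g‖⌉₊
    rw [div_le_iff₀ hpos] at hk1
    have hk3 : (k : ℝ) * ‖g‖ < ε / 4 + ‖g‖ := by
      calc (k : ℝ) * ‖g‖ < (ε / 4 / ‖g‖ + 1) * ‖g‖ := by gcongr
        _ = ε / 4 + ‖g‖ := by field_simp
    have hnorm : ‖k • g‖ = k * ‖g‖ := by
      rw [← Nat.cast_smul_eq_nsmul ℝ, norm_smul, Real.norm_natCast]
    exact ⟨k • g, by rw [hnorm]; linarith, (L n).nsmul_mem hg k, by rw [hnorm]; exact hk1⟩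
  obtain ⟨f, x, hf, hfx⟩ := exists_ultraLim_of_bounded h2
  have hle : ‖x‖ ≤ ε / 2 := le_of_tendsto hfx.norm (hf.mono fun n hn => hn.1)
  have hge : ε / 4 ≤ ‖x‖ := ge_of_tendsto hfx.norm (hf.mono fun n hn => hn.2.2)
  refine ⟨x, ⟨f, hf.mono fun n hn => hn.2.1, hfx⟩, ?_, by linarith⟩
  rintro rfl
  rw [norm_zero] at hge
  linarith

/-- If the points `f n` avoid the interiors of the convex sets `C n`, their limit avoids the
interior of the limit of the `C n`. -/
theorem notMem_interior_ultraLim [FiniteDimensional ℝ E] {𝒰 : Ultrafilter ℕ} {C : ℕ → Set E}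
    (hC : ∀ n, Convex ℝ (C n)) (hne : ∀ n, (interior (C n)).Nonempty) {f : ℕ → E} {x : E}
    (hf : ∀ᶠ n in 𝒰, f n ∉ interior (C n)) (hfx : Tendsto f 𝒰 (𝓝 x)) :
    x ∉ interior (ultraLim 𝒰 C) := by
  have h1 : ∀ᶠ n in 𝒰, ∃ φ : E →L[ℝ] ℝ, ‖φ‖ ≤ 1 ∧ (‖φ‖ = 1 ∧ ∀ y ∈ C n, φ y ≤ φ (f n)) := by
    filter_upwards [hf] with n hn
    obtain ⟨φ, hφ⟩ := geometric_hahn_banach_open_point (hC n).interior isOpen_interior hn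
    have hφ0 : φ ≠ 0 := by
      rintro rfl
      obtain ⟨a, ha⟩ := hne n
      simpa using hφ a ha
    have hle : ∀ y ∈ C n, φ y ≤ φ (f n) := by
      intro y hy
      have hy' : y ∈ closure (interior (C n)) := by
        rw [(hC n).closure_interior_eq_closure_of_nonempty_interior (hne n)]
        exact subset_closure hy
      exact closure_minimal (fun a ha => (hφ a ha).le)
        (isClosed_le φ.continuous continuous_const) hy'
    have hnorm : ‖‖φ‖⁻¹ • φ‖ = 1 := by
      rw [norm_smul, norm_inv, norm_norm, inv_mul_cancel₀ (norm_ne_zero_iff.2 hφ0)]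
    refine ⟨‖φ‖⁻¹ • φ, hnorm.le, hnorm, fun y hy => ?_⟩
    exact mul_le_mul_of_nonneg_left (hle y hy) (by positivity)
  obtain ⟨φ, ψ, hφ, hψ⟩ := exists_ultraLim_of_bounded h1
  have hψ1 : ‖ψ‖ = 1 :=
    tendsto_nhds_unique (hψ.norm) (tendsto_const_nhds.congr' (hφ.mono fun n hn => hn.2.1.symm))
  have happ : ∀ {g : ℕ → E} {y : E}, Tendsto g 𝒰 (𝓝 y) →
      Tendsto (fun n => φ n (g n)) 𝒰 (𝓝 (ψ y)) := fun hg =>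
    (isBoundedBilinearMap_apply.continuous.tendsto (ψ, _)).comp (hψ.prodMk_nhds hg)
  intro hx
  have hmax : ∀ y ∈ ultraLim 𝒰 C, ψ y ≤ ψ x := by
    rintro y ⟨g, hg, hgy⟩
    exact le_of_tendsto_of_tendsto (happ hgy) (happ hfx)
      ((hg.and hφ).mono fun n hn => hn.2.2.2 _ hn.1)
  have hψ0 : ψ = 0 := by
    ext v
    have hloc : IsLocalMax ψ x := by
      filter_upwards [mem_interior_iff_mem_nhds.1 hx] with y hy using hmax y hy
    have := hloc.hasFDerivAt_eq_zero ψ.hasFDerivAt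
    simp [this]
  simp [hψ0] at hψ1

end UltraLimits

theorem eventually_le_ultraLimSubgroup {d : ℕ} {𝒰 : Ultrafilter ℕ}
    (h𝒰 : (𝒰 : Filter ℕ) ≤ atTop) {L : ℕ → AddSubgroup (Fin d → ℝ)}
    (hL : ∀ n, intLattice d ≤ L n) : ∀ᶠ n in 𝒰, L n ≤ ultraLimSubgroup 𝒰 L := by
  set G := ultraLimSubgroup 𝒰 L with hG
  obtain ⟨δ, hδ, hmem⟩ := exists_mem_of_forall_nsmul_near (isClosed_ultraLimSubgroup h𝒰 L)
  by_contra hcon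
  rw [← Ultrafilter.eventually_not] at hcon
  have h1 : ∀ᶠ n in 𝒰, ∃ y, ‖y‖ ≤ 1 ∧ (y ∈ L n ∧ ∀ l ∈ G, δ ≤ ‖y - l‖) := by
    filter_upwards [hcon] with n hn
    obtain ⟨x, hx, hxG⟩ := SetLike.not_le_iff_exists.1 hn
    have := mt (hmem x) hxG
    push Not at this
    obtain ⟨k, hk⟩ := this
    obtain ⟨z, hz, hkz⟩ := exists_sub_mem_intLattice (k • x)
    refine ⟨k • x - z, hkz, (L n).sub_mem ((L n).nsmul_mem hx k) (hL n hz), fun l hl => ?_⟩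
    have hzG : z ∈ G := subset_ultraLim 𝒰 (fun n => hL n) hz
    rw [sub_sub]
    exact hk _ (G.add_mem hzG hl)
  obtain ⟨f, y, hf, hfy⟩ := exists_ultraLim_of_bounded h1
  have hyG : y ∈ G := ⟨f, hf.mono fun n hn => hn.2.1, hfy⟩
  have := ge_of_tendsto (hfy.sub_const y).norm (hf.mono fun n hn => hn.2.2 y hyG)
  simp at this
  linarith

/-- Lattice-free convex sets which are hulls of points of lattices with arbitrarily short
vectors admit an integral direction along which they remain lattice-free. -/
theorem exists_latticeFree_cylinder {d : ℕ} {L : ℕ → AddSubgroup (Fin d → ℝ)}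
    {C : ℕ → Set (Fin d → ℝ)} {K : Set (Fin d → ℝ)} {R : ℝ}
    (hL : ∀ n, intLattice d ≤ L n) (hCL : ∀ n, C n = convexHull ℝ (C n ∩ L n))
    (hCR : ∀ n, ∀ x ∈ C n, ‖x‖ ≤ R) (hKC : ∀ n, K ⊆ C n) (hK : (interior K).Nonempty)
    (hfree : ∀ n, interior (C n) ∩ L n = ∅)
    (hshort : ∀ n : ℕ, ∃ g ∈ L n, g ≠ 0 ∧ ‖g‖ < 1 / ((n : ℝ) + 1)) :
    ∃ n, ∃ r ∈ intLattice d, r ≠ 0 ∧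
      interior (cylinder (Submodule.span ℝ {r}) (C n)) ∩ L n = ∅ := by
  let 𝒰 : Ultrafilter ℕ := hyperfilter ℕ
  have h𝒰 : (𝒰 : Filter ℕ) ≤ atTop := Nat.hyperfilter_le_atTop
  set G := ultraLimSubgroup 𝒰 L with hG
  have hGcl : IsClosed (G : Set (Fin d → ℝ)) := isClosed_ultraLimSubgroup h𝒰 L
  have hconv : ∀ n, Convex ℝ (C n) := fun n => by rw [hCL n]; exact convex_convexHull ℝ _
  have hne : ∀ n, (interior (C n)).Nonempty := fun n => hK.mono (interior_mono (hKC n))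
  set D := ultraLim 𝒰 C with hD
  have hDconv : Convex ℝ D := convex_ultraLim 𝒰 hconv
  have hDne : (interior D).Nonempty := hK.mono (interior_mono (subset_ultraLim 𝒰 hKC))
  have hDG : ∀ x ∈ G, x ∉ interior D := by
    rintro x ⟨f, hf, hfx⟩
    refine notMem_interior_ultraLim hconv hne (hf.mono fun n hn hn' => ?_) hfx
    exact (hfree n).subset ⟨hn', hn⟩
  obtain ⟨r, hr, hr0, hrV⟩ := exists_intLattice_mem_linealitySpace hGcl
    (fun z hz => subset_ultraLim 𝒰 (fun n => hL n) hz)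
    (fun ε hε => exists_small_mem_ultraLimSubgroup h𝒰 hshort hε)
  obtain ⟨ε, hε, hsmall⟩ := exists_small_mem_linealitySpace hGcl
  have hLG := eventually_le_ultraLimSubgroup h𝒰 hL
  have hsub : ∀ᶠ n in 𝒰, C n ∩ L n ⊆ cylinder (linealitySpace G) D := by
    by_contra hcon
    rw [← Ultrafilter.eventually_not] at hcon
    have h1 : ∀ᶠ n in 𝒰, ∃ y, ‖y‖ ≤ R ∧ ((y ∈ C n ∧ y ∈ L n) ∧
        y ∉ cylinder (linealitySpace G) D) := by
      filter_upwards [hcon] with n hn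
      obtain ⟨y, hy, hyD⟩ := not_subset.1 hn
      exact ⟨y, hCR n y hy.1, hy, hyD⟩
    obtain ⟨f, y, hf, hfy⟩ := exists_ultraLim_of_bounded h1
    have hyD : y ∈ D := ⟨f, hf.mono fun n hn => hn.2.1.1, hfy⟩
    have hyG : y ∈ G := ⟨f, hf.mono fun n hn => hn.2.1.2, hfy⟩
    obtain ⟨n, hn, hLn, hdist⟩ := (hf.and (hLG.and
      (hfy.eventually (Metric.ball_mem_nhds y hε)))).exists
    apply hn.2.2
    refine ⟨y - f n, ?_, by simpa using hyD⟩
    refine hsmall _ (G.sub_mem hyG (hLn hn.2.1.2)) ?_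
    rwa [dist_comm, dist_eq_norm] at hdist
  obtain ⟨n, hn, hLn⟩ := (hsub.and hLG).exists
  refine ⟨n, r, hr, hr0, ?_⟩
  rw [eq_empty_iff_forall_notMem]
  rintro x ⟨hx, hxL⟩
  have hCn : C n ⊆ cylinder (linealitySpace G) D := by
    rw [hCL n]
    exact convexHull_min hn (convex_cylinder hDconv _)
  obtain ⟨v, hv, hxv⟩ := interior_cylinder_subset hDconv hDne _
    (interior_mono (cylinder_mono ((Submodule.span_singleton_le_iff_mem _ _).2 hrV) hCn) hx)
  exact hDG _ (G.add_mem (hLn hxL) (mem_of_mem_linealitySpace hv)) hxv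

section Polyhedra

variable {d : ℕ}

theorem isPolyhedron_of_linear {ι : Type*} [Fintype ι] (f : ι → (Fin d → ℝ) →ₗ[ℝ] ℝ) (b : ι → ℝ) :
    IsPolyhedron {x | ∀ i, f i x ≤ b i} := by
  let e := Fintype.equivFin ι
  refine ⟨Fintype.card ι, fun i j => f (e.symm i) (fun k => if j = k then 1 else 0),
    fun i => b (e.symm i), ?_⟩
  ext x
  simp only [mem_ofPred_eq]
  rw [← e.symm.forall_congr_right]
  refine forall_congr' fun i => ?_
  rw [LinearMap.pi_apply_eq_sum_univ (f (e.symm i)) x]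
  simp only [smul_eq_mul, mul_comm]

theorem IsPolyhedron.exists_linear {P : Set (Fin d → ℝ)} (hP : IsPolyhedron P) :
    ∃ (n : ℕ) (f : Fin n → (Fin d → ℝ) →ₗ[ℝ] ℝ) (b : Fin n → ℝ),
      P = {x | ∀ i, f i x ≤ b i} := by
  obtain ⟨n, A, b, rfl⟩ := hP
  refine ⟨n, fun i => ∑ j, A i j • LinearMap.proj j, b, ?_⟩
  simp

theorem IsPolyhedron.preimage {n : ℕ} {P : Set (Fin d → ℝ)} (hP : IsPolyhedron P)
    (g : (Fin n → ℝ) →ₗ[ℝ] (Fin d → ℝ)) : IsPolyhedron (g ⁻¹' P) := by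
  obtain ⟨k, f, b, rfl⟩ := hP.exists_linear
  exact isPolyhedron_of_linear (fun i => f i ∘ₗ g) b

/-- Fourier–Motzkin elimination: a polyhedron stays a polyhedron after adding a line. -/
theorem IsPolyhedron.cylinder_span_singleton {P : Set (Fin d → ℝ)} (hP : IsPolyhedron P)
    (r : Fin d → ℝ) : IsPolyhedron (cylinder (Submodule.span ℝ {r}) P) := by
  obtain ⟨n, f, b, rfl⟩ := hP.exists_linear
  let c : Fin n → ℝ := fun i => f i r
  let p : Fin n → Fin n → ℝ := fun i j =>
    if c i = 0 then 1 else if 0 < c i ∧ c j < 0 then -c j else 0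
  let q : Fin n → Fin n → ℝ := fun i j =>
    if c i = 0 then 0 else if 0 < c i ∧ c j < 0 then c i else 0
  suffices h : cylinder (Submodule.span ℝ {r}) {x | ∀ i, f i x ≤ b i} =
      {x | ∀ ij : Fin n × Fin n, (p ij.1 ij.2 • f ij.1 + q ij.1 ij.2 • f ij.2) x ≤
        p ij.1 ij.2 * b ij.1 + q ij.1 ij.2 * b ij.2} by
    rw [h]; exact isPolyhedron_of_linear _ _
  ext x
  simp only [cylinder, mem_ofPred_eq, Submodule.mem_span_singleton, Prod.forall,
    LinearMap.add_apply, LinearMap.smul_apply, smul_eq_mul]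
  constructor
  · rintro ⟨_, ⟨t, rfl⟩, ht⟩ i j
    have hi := ht i
    have hj := ht j
    simp only [map_add, map_smul, smul_eq_mul] at hi hj
    simp only [p, q, c]
    split_ifs with h1 h2
    · rw [h1] at hi; linarith
    · have h3 := mul_le_mul_of_nonneg_left hi (neg_pos.2 h2.2).le
      have h4 := mul_le_mul_of_nonneg_left hj h2.1.le
      nlinarith
    · simp
  · intro h
    have hzero : ∀ i, c i = 0 → f i x ≤ b i := fun i hi => by
      simpa [p, q, hi] using h i i
    have hpair : ∀ i j, 0 < c i → c j < 0 → (b j - f j x) / c j ≤ (b i - f i x) / c i := by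
      intro i j hi hj
      have := h i j
      simp only [p, q, hi.ne', hi, hj, and_self, if_true, if_false] at this
      rw [← neg_div_neg_eq, div_le_div_iff₀ (neg_pos.2 hj) hi]
      linarith
    obtain ⟨t, ht1, ht2⟩ : ∃ t, (∀ i, 0 < c i → t ≤ (b i - f i x) / c i) ∧
        (∀ j, c j < 0 → (b j - f j x) / c j ≤ t) := by
      let S : Finset (Fin n) := Finset.univ.filter fun i => 0 < c i
      by_cases hS : S.Nonempty
      · obtain ⟨i, hi, him⟩ := S.exists_min_image (fun i => (b i - f i x) / c i) hS
        exact ⟨_, fun k hk => him k (by simpa [S] using hk),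
          fun j hj => hpair i j (by simpa [S] using hi) hj⟩
      · let T : Finset (Fin n) := Finset.univ.filter fun i => c i < 0
        have hS' : ∀ i, ¬ 0 < c i := fun i hi => hS ⟨i, by simpa [S] using hi⟩
        by_cases hT : T.Nonempty
        · obtain ⟨j, hj, hjm⟩ := T.exists_max_image (fun i => (b i - f i x) / c i) hT
          exact ⟨_, fun i hi => absurd hi (hS' i), fun k hk => hjm k (by simpa [T] using hk)⟩
        · exact ⟨0, fun i hi => absurd hi (hS' i),
            fun k hk => absurd ⟨k, by simpa [T] using hk⟩ hT⟩
    refine ⟨t • r, ⟨t, rfl⟩, fun i => ?_⟩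
    rw [map_add, map_smul, smul_eq_mul]
    rcases lt_trichotomy (c i) 0 with hi | hi | hi
    · have := ht2 i hi
      rw [div_le_iff_of_neg hi] at this
      linarith
    · have h0 : f i r = 0 := hi
      rw [h0]
      linarith [hzero i hi]
    · have := ht1 i hi
      rw [le_div_iff₀ hi] at this
      linarith

theorem IsPolyhedron.exists_recession {P : Set (Fin d → ℝ)} (hP : IsPolyhedron P)
    (hb : ¬ Bornology.IsBounded P) :
    ∃ u : Fin d → ℝ, u ≠ 0 ∧ ∀ x ∈ P, ∀ t : ℝ, 0 ≤ t → x + t • u ∈ P := by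
  obtain ⟨n, f, b, rfl⟩ := hP.exists_linear
  have hx : ∀ k : ℕ, ∃ x, (∀ i, f i x ≤ b i) ∧ (k : ℝ) + 1 < ‖x‖ := by
    intro k
    by_contra! h
    exact hb ((Metric.isBounded_closedBall (x := (0 : Fin d → ℝ)) (r := (k : ℝ) + 1)).subset
      fun x hx => by simpa using h x hx)
  choose x hxP hxn using hx
  have hpos : ∀ k, 0 < ‖x k‖ := fun k => lt_trans (by positivity) (hxn k)
  have hinv : Tendsto (fun k => ‖x k‖⁻¹) atTop (𝓝 0) :=
    squeeze_zero (fun k => by positivity)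
      (fun k => by
        rw [← one_div]
        exact one_div_le_one_div_of_le (by positivity) (hxn k).le)
      tendsto_one_div_add_atTop_nhds_zero_nat
  obtain ⟨u, hu, φ, hφ, hlim⟩ := (isCompact_sphere (0 : Fin d → ℝ) 1).tendsto_subseq
    (x := fun k => ‖x k‖⁻¹ • x k) (fun k => by simp [norm_smul, (hpos k).ne'])
  have hfu : ∀ i, f i u ≤ 0 := by
    intro i
    have h1 : Tendsto (fun k => f i (‖x (φ k)‖⁻¹ • x (φ k))) atTop (𝓝 (f i u)) :=
      ((LinearMap.continuous_of_finiteDimensional (f i)).tendsto u).comp hlim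
    have h2 : Tendsto (fun k => ‖x (φ k)‖⁻¹ * b i) atTop (𝓝 (0 * b i)) :=
      (hinv.comp hφ.tendsto_atTop).mul_const _
    rw [zero_mul] at h2
    refine le_of_tendsto_of_tendsto' h1 h2 fun k => ?_
    rw [map_smul, smul_eq_mul]
    exact mul_le_mul_of_nonneg_left (hxP _ i) (by positivity)
  refine ⟨u, fun h => by simp [h] at hu, fun y hy t ht i => ?_⟩
  rw [map_add, map_smul, smul_eq_mul]
  nlinarith [hy i, hfu i]

theorem IsIntegralPoly.convex {P : Set (Fin d → ℝ)} (hP : IsIntegralPoly P) : Convex ℝ P := by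
  rw [hP]; exact convex_convexHull ℝ _

/-- A convex set invariant under translation by `r` and `-r` is invariant under the line of `r`. -/
theorem add_smul_mem_of_forall_zsmul {H : Set (Fin d → ℝ)} (hH : Convex ℝ H) {r : Fin d → ℝ}
    (hr : ∀ x ∈ H, ∀ k : ℤ, x + (k : ℝ) • r ∈ H) {x : Fin d → ℝ} (hx : x ∈ H) (t : ℝ) :
    x + t • r ∈ H := by
  have h1 := hr x hx ⌊t⌋
  have h2 := hr x hx (⌊t⌋ + 1)
  have h3 := hH h1 h2 (a := 1 - Int.fract t) (b := Int.fract t)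
    (by linarith [Int.fract_lt_one t]) (Int.fract_nonneg t) (by ring)
  convert h3 using 1
  conv_lhs => rw [← Int.floor_add_fract t]
  push_cast
  module

theorem convexHull_inter_intPts_add_smul_mem {S : Set (Fin d → ℝ)} {r : Fin d → ℝ}
    (hr : r ∈ intPts d) (hS : ∀ x ∈ S, ∀ t : ℝ, x + t • r ∈ S) {x : Fin d → ℝ}
    (hx : x ∈ convexHull ℝ (S ∩ intPts d)) (t : ℝ) :
    x + t • r ∈ convexHull ℝ (S ∩ intPts d) := by
  refine add_smul_mem_of_forall_zsmul (convex_convexHull ℝ _) (fun y hy k => ?_) hx t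
  have hsub : S ∩ intPts d ⊆ (fun y => y + (k : ℝ) • r) ⁻¹' convexHull ℝ (S ∩ intPts d) := by
    rintro z ⟨hzS, hz⟩
    refine subset_convexHull ℝ _ ⟨hS z hzS k, ?_⟩
    have := (intLattice d).add_mem hz ((intLattice d).zsmul_mem hr k)
    rwa [← Int.cast_smul_eq_zsmul ℝ] at this
  refine convexHull_min hsub ?_ hy
  exact (convex_convexHull ℝ (S ∩ intPts d)).translate_preimage_left _

theorem cylinder_add_smul_mem {S : Set (Fin d → ℝ)} {r x : Fin d → ℝ}
    (hx : x ∈ cylinder (Submodule.span ℝ {r}) S) (t : ℝ) :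
    x + t • r ∈ cylinder (Submodule.span ℝ {r}) S := by
  obtain ⟨v, hv, hxv⟩ := hx
  refine ⟨v - t • r, Submodule.sub_mem _ hv (Submodule.smul_mem _ _
    (Submodule.mem_span_singleton_self r)), ?_⟩
  convert hxv using 1
  abel

theorem LatFreeIntegral.cylinder {P : Set (Fin d → ℝ)} (hP : LatFreeIntegral d P)
    {r : Fin d → ℝ} (hr : r ∈ intPts d)
    (hfree : interior (cylinder (Submodule.span ℝ {r}) P) ∩ intPts d = ∅) :
    LatFreeIntegral d (cylinder (Submodule.span ℝ {r}) P) := by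
  obtain ⟨hpoly, hne, -, hhull⟩ := hP
  refine ⟨hpoly.cylinder_span_singleton r, hne.mono (interior_mono (subset_cylinder _ _)),
    hfree, Subset.antisymm ?_ (convexHull_min inter_subset_left (convex_cylinder hhull.convex _))⟩
  rintro x ⟨v, hv, hxv⟩
  obtain ⟨t, rfl⟩ := Submodule.mem_span_singleton.1 hv
  have h1 : x + t • r ∈ convexHull ℝ (_root_.cylinder (Submodule.span ℝ {r}) P ∩ intPts d) := by
    rw [hhull] at hxv
    exact convexHull_mono (inter_subset_inter_left _ (subset_cylinder _ _)) hxv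
  have h2 := convexHull_inter_intPts_add_smul_mem hr
    (fun y hy t => cylinder_add_smul_mem hy t) h1 (-t)
  simpa using h2

theorem MemI.cylinder_eq {P : Set (Fin d → ℝ)} (hP : MemI d P) {r : Fin d → ℝ}
    (hr : r ∈ intPts d)
    (hfree : interior (cylinder (Submodule.span ℝ {r}) P) ∩ intPts d = ∅) :
    cylinder (Submodule.span ℝ {r}) P = P :=
  (hP.2 _ (hP.1.cylinder hr hfree) (subset_cylinder _ _)).symm

/-- A maximal lattice-free integral polyhedron is unbounded only if it is invariant under
translations along some integral direction. -/
theorem MemI.exists_cylinder_eq_of_not_isBounded {P : Set (Fin d → ℝ)} (hP : MemI d P)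
    (hb : ¬ Bornology.IsBounded P) :
    ∃ r ∈ intPts d, r ≠ 0 ∧ cylinder (Submodule.span ℝ {r}) P = P := by
  obtain ⟨hpoly, hne, hfree, hhull⟩ := hP.1
  obtain ⟨u, hu0, hu⟩ := hpoly.exists_recession hb
  have hrec : ∀ {x ρ}, Metric.ball x ρ ⊆ P → ∀ t : ℝ, 0 ≤ t → Metric.ball (x + t • u) ρ ⊆ P := by
    intro x ρ hx t ht y hy
    have h1 : y - t • u ∈ Metric.ball x ρ := by
      rw [Metric.mem_ball, dist_eq_norm] at hy ⊢
      convert hy using 2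
      abel
    simpa using hu _ (hx h1) t ht
  let G : AddSubgroup (Fin d → ℝ) :=
    (intLattice d ⊔ (Submodule.span ℝ {u}).toAddSubgroup).topologicalClosure
  have hsub : intLattice d ⊔ (Submodule.span ℝ {u}).toAddSubgroup ≤ G :=
    AddSubgroup.le_topologicalClosure _
  have hGcl : IsClosed (G : Set (Fin d → ℝ)) := AddSubgroup.isClosed_topologicalClosure _
  have hdisj : ∀ x ∈ G, x ∉ interior P := by
    intro x hx hxP
    obtain ⟨y, hyP, hy⟩ := mem_closure_iff.1 hx _ isOpen_interior hxP
    obtain ⟨z, hz, v, hv, rfl⟩ := AddSubgroup.mem_sup.1 hy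
    obtain ⟨t, rfl⟩ := Submodule.mem_span_singleton.1 hv
    obtain ⟨ρ, hρ, hball⟩ := Metric.isOpen_iff.1 isOpen_interior _ hyP
    obtain ⟨N, hN⟩ := exists_bound_nsmul_near_intLattice d hρ
    obtain ⟨k, hk, -, m, hm, hkm⟩ := hN ((|t| + 1) • u)
    have hk1 : (1 : ℝ) ≤ k := by exact_mod_cast hk
    have hs : 0 ≤ (k : ℝ) * (|t| + 1) - t := by
      nlinarith [le_abs_self t, abs_nonneg t]
    have hb' := hrec (hball.trans interior_subset) _ hs
    have hzm : z + m ∈ Metric.ball (z + t • u + ((k : ℝ) * (|t| + 1) - t) • u) ρ := by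
      have heq : z + t • u + ((k : ℝ) * (|t| + 1) - t) • u - (z + m)
          = k • ((|t| + 1) • u) - m := by
        rw [← Nat.cast_smul_eq_nsmul ℝ]
        module
      rw [Metric.mem_ball, dist_comm, dist_eq_norm, heq]
      exact hkm
    have := interior_maximal hb' Metric.isOpen_ball hzm
    exact hfree.subset ⟨this, (intLattice d).add_mem hz hm⟩
  have huG : ∀ t : ℝ, t • u ∈ G := fun t => hsub (AddSubgroup.mem_sup_right
    (Submodule.smul_mem _ _ (Submodule.mem_span_singleton_self u)))
  obtain ⟨r, hr, hr0, hrV⟩ := exists_intLattice_mem_linealitySpace hGcl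
    (fun z hz => hsub (AddSubgroup.mem_sup_left hz)) (fun ε hε => by
      have hpos : 0 < ‖u‖ := norm_pos_iff.2 hu0
      refine ⟨(ε / 2 / ‖u‖) • u, huG _, smul_ne_zero (by positivity) hu0, ?_⟩
      rw [norm_smul, Real.norm_of_nonneg (by positivity)]
      field_simp
      linarith)
  refine ⟨r, hr, hr0, hP.cylinder_eq hr ?_⟩
  rw [eq_empty_iff_forall_notMem]
  rintro x ⟨hx, hxZ⟩
  obtain ⟨v, hv, hxv⟩ := interior_cylinder_subset hhull.convex hne _ hx
  refine hdisj _ (G.add_mem (hsub (AddSubgroup.mem_sup_left hxZ))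
    (mem_of_mem_linealitySpace ?_)) hxv
  exact (Submodule.span_singleton_le_iff_mem _ _).2 hrV hv

/-- Pulling back along an integral projection with one-dimensional kernel preserves and reflects
being a lattice-free integral polyhedron. -/
theorem latFreeIntegral_preimage_iff {n : ℕ} {f : (Fin n → ℝ) →ₗ[ℝ] (Fin d → ℝ)}
    {s : (Fin d → ℝ) →ₗ[ℝ] (Fin n → ℝ)} {r : Fin n → ℝ} (hfs : ∀ y, f (s y) = y)
    (hr : r ∈ intPts n) (hfr : f r = 0) (hker : ∀ x, ∃ t : ℝ, x = s (f x) + t • r)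
    (hf : ∀ x ∈ intPts n, f x ∈ intPts d) (hs : ∀ y ∈ intPts d, s y ∈ intPts n)
    {S : Set (Fin d → ℝ)} :
    LatFreeIntegral n (f ⁻¹' S) ↔ LatFreeIntegral d S := by
  have hfc : Continuous f := f.continuous_of_finiteDimensional
  have hsc : Continuous s := s.continuous_of_finiteDimensional
  have hsurj : Function.Surjective f := fun y => ⟨s y, hfs y⟩
  have hopen : IsOpenMap f := f.toContinuousLinearMap.isOpenMap hsurj
  have hS : s ⁻¹' (f ⁻¹' S) = S := by ext y; simp [hfs]
  have hhull : interior (f ⁻¹' S) = f ⁻¹' interior S :=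
    (hopen.preimage_interior_eq_interior_preimage hfc S).symm
  have hpoly : IsPolyhedron (f ⁻¹' S) ↔ IsPolyhedron S :=
    ⟨fun h => hS ▸ h.preimage s, fun h => h.preimage f⟩
  have hne : (interior (f ⁻¹' S)).Nonempty ↔ (interior S).Nonempty := by
    rw [hhull]
    exact ⟨fun ⟨x, hx⟩ => ⟨f x, hx⟩, fun ⟨y, hy⟩ => ⟨s y, by simpa [hfs] using hy⟩⟩
  have hfree : interior (f ⁻¹' S) ∩ intPts n = ∅ ↔ interior S ∩ intPts d = ∅ := by
    rw [hhull, eq_empty_iff_forall_notMem, eq_empty_iff_forall_notMem]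
    exact ⟨fun h y hy => h (s y) ⟨by simpa [hfs] using hy.1, hs y hy.2⟩,
      fun h x hx => h (f x) ⟨hx.1, hf x hx.2⟩⟩
  have hintegral : IsIntegralPoly (f ⁻¹' S) ↔ IsIntegralPoly S := by
    constructor
    · intro h
      have hconv : Convex ℝ S := by
        have := h.convex.linear_preimage s
        rwa [hS] at this
      refine Subset.antisymm (fun y hy => ?_) (convexHull_min inter_subset_left hconv)
      have h1 : s y ∈ convexHull ℝ (f ⁻¹' S ∩ intPts n) := by
        rw [← h]; simpa [hfs] using hy
      have h2 : f (s y) ∈ f '' convexHull ℝ (f ⁻¹' S ∩ intPts n) := mem_image_of_mem _ h1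
      rw [f.image_convexHull, hfs] at h2
      refine convexHull_mono ?_ h2
      rintro _ ⟨x, hx, rfl⟩
      exact ⟨hx.1, hf x hx.2⟩
    · intro h
      refine Subset.antisymm (fun x hx => ?_)
        (convexHull_min inter_subset_left (h.convex.linear_preimage f))
      have h1 : f x ∈ convexHull ℝ (S ∩ intPts d) := by rw [← h]; exact hx
      have h2 : s (f x) ∈ s '' convexHull ℝ (S ∩ intPts d) := mem_image_of_mem _ h1
      rw [s.image_convexHull] at h2
      have h3 : s (f x) ∈ convexHull ℝ (f ⁻¹' S ∩ intPts n) := by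
        refine convexHull_mono ?_ h2
        rintro _ ⟨y, hy, rfl⟩
        exact ⟨by simpa [hfs] using hy.1, hs y hy.2⟩
      obtain ⟨t, ht⟩ := hker x
      rw [ht]
      refine convexHull_inter_intPts_add_smul_mem hr (fun y hy t => ?_) h3 t
      simpa [hfr] using hy
  rw [LatFreeIntegral, LatFreeIntegral, hpoly, hne, hfree, hintegral]

end Polyhedra

section UnimodularEquivalence

variable {d : ℕ}

/-- Two sets are unimodularly equivalent if an affine automorphism of `ℤ^d` maps one to the
other. -/
def UnimodEquiv (P Q : Set (Fin d → ℝ)) : Prop :=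
  ∃ φ : (Fin d → ℝ) ≃ᵃ[ℝ] (Fin d → ℝ), (∀ x, φ x ∈ intPts d ↔ x ∈ intPts d) ∧ P = φ '' Q

theorem UnimodEquiv.symm {P Q : Set (Fin d → ℝ)} (h : UnimodEquiv P Q) : UnimodEquiv Q P := by
  obtain ⟨φ, hφ, rfl⟩ := h
  refine ⟨φ.symm, fun x => by rw [← hφ, φ.apply_symm_apply], ?_⟩
  rw [← image_comp]
  simp

theorem UnimodEquiv.trans {P Q R : Set (Fin d → ℝ)} (h : UnimodEquiv P Q)
    (h' : UnimodEquiv Q R) : UnimodEquiv P R := by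
  obtain ⟨φ, hφ, rfl⟩ := h
  obtain ⟨ψ, hψ, rfl⟩ := h'
  exact ⟨ψ.trans φ, fun x => by simp [hφ, hψ], by rw [← image_comp]; rfl⟩

/-- The linear part of an affine automorphism preserving `ℤ^d` has an integral matrix. -/
theorem exists_map_intCast_eq_toMatrix' {φ : (Fin d → ℝ) ≃ᵃ[ℝ] (Fin d → ℝ)}
    (hφ : ∀ x ∈ intPts d, φ x ∈ intPts d) :
    ∃ U : Matrix (Fin d) (Fin d) ℤ,
      U.map (Int.cast : ℤ → ℝ) =
        LinearMap.toMatrix' (φ.linear : (Fin d → ℝ) →ₗ[ℝ] (Fin d → ℝ)) := by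
  have h : ∀ i j, ∃ z : ℤ,
      (z : ℝ) = LinearMap.toMatrix' (φ.linear : (Fin d → ℝ) →ₗ[ℝ] (Fin d → ℝ)) i j := by
    intro i j
    have h1 : φ.linear (Pi.single j 1) = φ (Pi.single j 1) - φ 0 := by
      have := φ.map_vadd 0 (Pi.single j 1)
      simp only [vadd_eq_add, add_zero] at this
      rw [this, add_sub_cancel_right]
    have h2 : φ.linear (Pi.single j 1) ∈ intLattice d := by
      rw [h1]
      exact (intLattice d).sub_mem (hφ _ (single_mem_intLattice j)) (hφ _ (intLattice d).zero_mem)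
    obtain ⟨z, hz⟩ := h2 i
    refine ⟨z, ?_⟩
    rw [LinearMap.toMatrix'_apply, ← hz]
    congr 2
  choose U hU using h
  exact ⟨Matrix.of U, by ext i j; simpa using hU i j⟩

theorem UnimodEquiv.exists_matrix {P Q : Set (Fin d → ℝ)} (h : UnimodEquiv P Q) :
    ∃ (U : Matrix (Fin d) (Fin d) ℤ) (v : Fin d → ℤ),
      |U.det| = 1 ∧ P = affMap U (fun i => (v i : ℝ)) '' Q := by
  obtain ⟨φ, hφ, rfl⟩ := h
  obtain ⟨U, hU⟩ := exists_map_intCast_eq_toMatrix' fun x hx => (hφ x).2 hx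
  obtain ⟨V, hV⟩ := exists_map_intCast_eq_toMatrix' (φ := φ.symm)
    fun x hx => by rwa [← hφ, φ.apply_symm_apply]
  obtain ⟨v, hv⟩ := exists_intCast_eq ((hφ 0).2 (intLattice d).zero_mem)
  refine ⟨U, v, ?_, ?_⟩
  · have h1 : U.map (Int.cast : ℤ → ℝ) * V.map (Int.cast : ℤ → ℝ) = 1 := by
      rw [hU, hV, ← LinearMap.toMatrix'_comp]
      convert LinearMap.toMatrix'_id
      ext x : 1
      simp
    have h2 : (U * V).map (Int.cast : ℤ → ℝ) = (1 : Matrix (Fin d) (Fin d) ℤ).map Int.cast := by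
      rw [Matrix.map_one _ Int.cast_zero Int.cast_one, ← h1]
      exact Matrix.map_mul (f := Int.castRingHom ℝ)
    have h3 : U * V = 1 := Matrix.map_injective Int.cast_injective h2
    have h4 : U.det * V.det = 1 := by rw [← Matrix.det_mul, h3, Matrix.det_one]
    exact Int.isUnit_iff_abs_eq.1 (IsUnit.of_mul_eq_one _ h4)
  · refine image_congr fun x _ => ?_
    have h1 : φ x = φ.linear x + φ 0 := by
      have := φ.map_vadd 0 x
      simpa only [vadd_eq_add, add_zero] using this
    have h2 : φ.linear x = (U.map (Int.cast : ℤ → ℝ)).mulVec x := by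
      rw [hU, ← Matrix.toLin'_apply, Matrix.toLin'_toMatrix']
      rfl
    rw [h1, h2, hv]
    ext i
    simp [affMap, Matrix.mulVec, dotProduct]

/-- A family of sets that meets only finitely many unimodular equivalence classes. -/
def FinClass (S : Set (Set (Fin d → ℝ))) : Prop :=
  ∃ T : Set (Set (Fin d → ℝ)), T.Finite ∧ ∀ P ∈ S, ∃ Q ∈ T, UnimodEquiv P Q

theorem FinClass.mono {S S' : Set (Set (Fin d → ℝ))} (h : FinClass S') (hS : S ⊆ S') :
    FinClass S := by
  obtain ⟨T, hT, h⟩ := h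
  exact ⟨T, hT, fun P hP => h P (hS hP)⟩

theorem FinClass.union {S S' : Set (Set (Fin d → ℝ))} (h : FinClass S) (h' : FinClass S') :
    FinClass (S ∪ S') := by
  obtain ⟨T, hT, h⟩ := h
  obtain ⟨T', hT', h'⟩ := h'
  refine ⟨T ∪ T', hT.union hT', ?_⟩
  rintro P (hP | hP)
  · obtain ⟨Q, hQ, hPQ⟩ := h P hP
    exact ⟨Q, Or.inl hQ, hPQ⟩
  · obtain ⟨Q, hQ, hPQ⟩ := h' P hP
    exact ⟨Q, Or.inr hQ, hPQ⟩

/-- A family is finite up to equivalence if its members have an invariant in a finite set that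
determines them up to equivalence. -/
theorem finClass_of_invariant {β : Type*} {S : Set (Set (Fin d → ℝ))} {F : Set β}
    (hF : F.Finite) (ρ : Set (Fin d → ℝ) → β → Prop) (hS : ∀ P ∈ S, ∃ b ∈ F, ρ P b)
    (hρ : ∀ P Q b, ρ P b → ρ Q b → UnimodEquiv P Q) : FinClass S := by
  classical
  refine ⟨(fun b => Classical.epsilon fun P => ρ P b) '' F, hF.image _, fun P hP => ?_⟩
  obtain ⟨b, hb, hPb⟩ := hS P hP
  exact ⟨_, mem_image_of_mem _ hb,
    hρ _ _ b hPb (Classical.epsilon_spec (p := fun P => ρ P b) ⟨P, hPb⟩)⟩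

/-- Representatives of a family that is finite up to equivalence can be chosen inside the
family. -/
theorem FinClass.exists_fin {S : Set (Set (Fin d → ℝ))} (h : FinClass S) :
    ∃ (N : ℕ) (Ps : Fin N → Set (Fin d → ℝ)),
      (∀ j, Ps j ∈ S) ∧ ∀ P ∈ S, ∃ j, UnimodEquiv P (Ps j) := by
  obtain ⟨T, hT, h⟩ := h
  let T' : Set (Set (Fin d → ℝ)) := {Q ∈ T | ∃ P ∈ S, UnimodEquiv P Q}
  have hT' : T'.Finite := hT.subset (sep_subset _ _)
  have := hT'.fintype
  have hrep : ∀ Q : T', ∃ P ∈ S, UnimodEquiv P Q := fun Q => Q.2.2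
  choose p hpS hp using hrep
  let e := Fintype.equivFin T'
  refine ⟨Fintype.card T', fun j => p (e.symm j), fun j => hpS _, fun P hP => ?_⟩
  obtain ⟨Q, hQ, hPQ⟩ := h P hP
  let q : T' := ⟨Q, hQ, P, hP, hPQ⟩
  exact ⟨e q, by simpa [q] using hPQ.trans (hp q).symm⟩

end UnimodularEquivalence

section Frames

variable {d : ℕ}

/-- A frame of `P` is an integral affine coordinate system whose origin and unit points lie in `P`
and with respect to which `P` has coordinates bounded by one. -/
structure IsFrame (P : Set (Fin d → ℝ)) (T : (Fin d → ℝ) ≃ᵃ[ℝ] (Fin d → ℝ)) : Prop where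
  map_intPts : ∀ x ∈ intPts d, T x ∈ intPts d
  norm_le : ∀ x, T x ∈ P → ‖x‖ ≤ 1
  zero_mem : T 0 ∈ P
  single_mem : ∀ i, T (Pi.single i 1) ∈ P

/-- The lattice `ℤ^d` in the linear coordinates given by `T`. -/
def frameLattice (T : (Fin d → ℝ) ≃ᵃ[ℝ] (Fin d → ℝ)) : AddSubgroup (Fin d → ℝ) :=
  (intLattice d).comap (T.linear : (Fin d → ℝ) →ₗ[ℝ] (Fin d → ℝ)).toAddMonoidHom

theorem affineEquiv_apply_eq (T : (Fin d → ℝ) ≃ᵃ[ℝ] (Fin d → ℝ)) (x : Fin d → ℝ) :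
    T x = T.linear x + T 0 := by
  have := T.map_vadd 0 x
  simpa only [vadd_eq_add, add_zero] using this

variable {P Q : Set (Fin d → ℝ)} {T T' : (Fin d → ℝ) ≃ᵃ[ℝ] (Fin d → ℝ)}

theorem IsFrame.mem_frameLattice_iff (hT : IsFrame P T) {x : Fin d → ℝ} :
    x ∈ frameLattice T ↔ T x ∈ intPts d := by
  have h0 : T 0 ∈ intLattice d := hT.map_intPts _ (intLattice d).zero_mem
  rw [affineEquiv_apply_eq]
  exact ((intLattice d).add_mem_cancel_right h0).symm

theorem IsFrame.intLattice_le (hT : IsFrame P T) : intLattice d ≤ frameLattice T :=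
  fun x hx => hT.mem_frameLattice_iff.2 (hT.map_intPts x hx)

theorem IsFrame.preimage_eq_convexHull (hT : IsFrame P T) (hP : IsIntegralPoly P) :
    T ⁻¹' P = convexHull ℝ (T ⁻¹' P ∩ frameLattice T) := by
  have h1 : T ⁻¹' P ∩ frameLattice T = T.symm '' (P ∩ intPts d) := by
    ext x
    constructor
    · rintro ⟨hx, hxL⟩
      exact ⟨T x, ⟨hx, hT.mem_frameLattice_iff.1 hxL⟩, by simp⟩
    · rintro ⟨y, hy, rfl⟩
      exact ⟨by simpa using hy.1, hT.mem_frameLattice_iff.2 (by simpa using hy.2)⟩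
  have h2 := (T.symm : (Fin d → ℝ) →ᵃ[ℝ] (Fin d → ℝ)).image_convexHull (P ∩ intPts d)
  rw [← hP] at h2
  rw [h1]
  refine Eq.trans ?_ h2
  ext x
  constructor
  · intro hx
    exact ⟨T x, hx, by simp⟩
  · rintro ⟨y, hy, rfl⟩
    simpa using hy

theorem exists_isFrame (hP : IsIntegralPoly P) (hne : (interior P).Nonempty)
    (hb : Bornology.IsBounded P) : ∃ T, IsFrame P T := by
  set S := P ∩ intPts d with hS
  have hSfin : S.Finite := finite_intLattice_inter hb
  have hPS : P = convexHull ℝ S := hP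
  have hspan : affineSpan ℝ S = ⊤ := by
    rwa [← interior_convexHull_nonempty_iff_affineSpan_eq_top, ← hPS]
  have hSne : S.Nonempty := by
    rw [← convexHull_nonempty_iff (𝕜 := ℝ), ← hPS]
    exact hne.mono interior_subset
  let M : (Fin d → ℝ) × (Fin d → Fin d → ℝ) → Matrix (Fin d) (Fin d) ℝ :=
    fun p => Matrix.of fun i => p.2 i - p.1
  obtain ⟨p₀, hp₀S, hp₀⟩ : ∃ p ∈ S ×ˢ univ.pi fun _ : Fin d => S, (M p).det ≠ 0 := by
    obtain ⟨w₀, hw₀⟩ := hSne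
    rw [AffineSubspace.affineSpan_eq_top_iff_vectorSpan_eq_top_of_nonempty ℝ _ _ ⟨w₀, hw₀⟩,
      vectorSpan_eq_span_vsub_set_right ℝ hw₀] at hspan
    obtain ⟨f, hf, -, hli⟩ := Submodule.exists_fun_fin_finrank_span_eq ℝ ((fun x => x -ᵥ w₀) '' S)
    have hd : d = Module.finrank ℝ (Submodule.span ℝ ((fun x => x -ᵥ w₀) '' S)) := by
      rw [hspan]; simp
    choose g hgS hg using fun i => hf (finCongr hd i)
    refine ⟨(w₀, g), ⟨hw₀, fun i _ => hgS i⟩, ?_⟩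
    have hrow : (M (w₀, g)).row = f ∘ finCongr hd := funext hg
    rw [← isUnit_iff_ne_zero, ← Matrix.isUnit_iff_isUnit_det,
      ← Matrix.linearIndependent_rows_iff_isUnit, hrow]
    exact hli.comp _ (finCongr hd).injective
  obtain ⟨⟨w₀, w⟩, ⟨hw₀, hw⟩, hmax⟩ := Set.exists_max_image _ (fun p => |(M p).det|)
    (hSfin.prod (Set.Finite.pi fun _ => hSfin)) ⟨p₀, hp₀S⟩
  have hdet : 0 < |(M (w₀, w)).det| := (abs_pos.2 hp₀).trans_le (hmax _ hp₀S)
  have hli : LinearIndependent ℝ (M (w₀, w)).row := by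
    rw [Matrix.linearIndependent_rows_iff_isUnit, Matrix.isUnit_iff_isUnit_det,
      isUnit_iff_ne_zero]
    exact abs_pos.1 hdet
  let b := Module.Basis.mk hli (hli.span_eq_top_of_card_eq_finrank' (by simp)).ge
  have hbi : ∀ i, b i = w i - w₀ := fun i => Module.Basis.mk_apply _ _ i
  let T : (Fin d → ℝ) ≃ᵃ[ℝ] (Fin d → ℝ) :=
    b.equivFun.symm.toAffineEquiv.trans (AffineEquiv.constVAdd ℝ (Fin d → ℝ) w₀)
  have hTx : ∀ x, T x = w₀ + ∑ i, x i • (w i - w₀) := by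
    intro x
    have : T x = w₀ + b.equivFun.symm x := rfl
    rw [this, b.equivFun_symm_apply]
    simp only [hbi]
  refine ⟨T, ?_, ?_, ?_, ?_⟩
  · intro x hx
    rw [hTx]
    refine (intLattice d).add_mem hw₀.2 ((intLattice d).sum_mem fun i _ => ?_)
    obtain ⟨z, hz⟩ := hx i
    rw [hz, Int.cast_smul_eq_zsmul]
    exact (intLattice d).zsmul_mem ((intLattice d).sub_mem (hw i trivial).2 hw₀.2) z
  · have hsub : S ⊆ T.symm ⁻¹' Metric.closedBall 0 1 := by
      intro s hs
      rw [mem_preimage, mem_closedBall_zero_iff, pi_norm_le_iff_of_nonneg zero_le_one]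
      intro i
      set x := T.symm s with hx
      have hsx : s - w₀ = ∑ k, x k • M (w₀, w) k := by
        have : T x = s := T.apply_symm_apply s
        rw [← this, hTx, add_sub_cancel_left]
        rfl
      have hM : M (w₀, Function.update w i s) = (M (w₀, w)).updateRow i (s - w₀) := by
        ext k j
        by_cases hk : k = i
        · subst hk; simp [M]
        · simp [M, hk]
      have hle := hmax (w₀, Function.update w i s) ⟨hw₀, fun k _ => by
        by_cases hk : k = i
        · subst hk; simpa using hs
        · simpa [hk] using hw k trivial⟩
      simp only [hM, hsx, Matrix.det_updateRow_sum, smul_eq_mul, abs_mul] at hle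
      exact le_of_mul_le_mul_right (by simpa using hle) hdet
    have hconv : P ⊆ T.symm ⁻¹' Metric.closedBall 0 1 := by
      rw [hPS]
      exact convexHull_min hsub ((convex_closedBall 0 1).affine_preimage
        (T.symm : (Fin d → ℝ) →ᵃ[ℝ] (Fin d → ℝ)))
    intro x hx
    simpa using hconv hx
  · rw [hTx]
    simpa using hw₀.1
  · intro i
    rw [hTx]
    simpa [Pi.single_apply] using (hw i trivial).1

theorem IsFrame.frameLattice_le (hT : IsFrame P T) (hT' : IsFrame Q T')
    (h : (frameLattice T : Set (Fin d → ℝ)) ∩ Metric.closedBall 0 1 ⊆ frameLattice T') :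
    frameLattice T ≤ frameLattice T' := by
  intro x hx
  obtain ⟨z, hz, hxz⟩ := exists_sub_mem_intLattice x
  have h1 : x - z ∈ frameLattice T' :=
    h ⟨(frameLattice T).sub_mem hx (hT.intLattice_le hz), by simpa using hxz⟩
  simpa using (frameLattice T').add_mem h1 (hT'.intLattice_le hz)

/-- Integral polytopes having a frame whose lattice contains no short vectors form finitely many
classes. -/
theorem finClass_of_forall_le_norm (d : ℕ) {ε : ℝ} (hε : 0 < ε) :
    FinClass {P : Set (Fin d → ℝ) | IsIntegralPoly P ∧
      ∃ T, IsFrame P T ∧ ∀ g ∈ frameLattice T, g ≠ 0 → ε ≤ ‖g‖} := by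
  obtain ⟨N, hN⟩ := exists_bound_nsmul_near_intLattice d hε
  let F₀ : Set (Fin d → ℝ) := {x | ‖x‖ ≤ 1 ∧ N.factorial • x ∈ intPts d}
  have hF₀ : F₀.Finite := by
    have h1 := finite_intLattice_inter
      (Metric.isBounded_closedBall (x := (0 : Fin d → ℝ)) (r := N.factorial))
    refine Set.Finite.of_injOn (f := fun x => N.factorial • x) ?_ ?_ h1
    · refine fun x hx => ⟨?_, hx.2⟩
      beta_reduce
      rw [mem_closedBall_zero_iff, ← Nat.cast_smul_eq_nsmul ℝ, norm_smul]
      simpa using mul_le_mul_of_nonneg_left hx.1 (Nat.cast_nonneg (α := ℝ) N.factorial)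
    · exact (smul_right_injective _ N.factorial_ne_zero).injOn
  refine finClass_of_invariant (hF₀.powerset.prod hF₀.powerset)
    (fun P b => IsIntegralPoly P ∧ ∃ T, IsFrame P T ∧
      b = ((frameLattice T : Set (Fin d → ℝ)) ∩ Metric.closedBall 0 1,
        T ⁻¹' P ∩ (frameLattice T : Set (Fin d → ℝ)))) ?_ ?_
  · rintro P ⟨hP, T, hT, hlong⟩
    have hmul : ∀ g ∈ frameLattice T, N.factorial • g ∈ intPts d := by
      intro g hg
      obtain ⟨k, hk, hkN, z, hz, hkz⟩ := hN g
      have h0 : k • g - z = 0 := by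
        by_contra h
        exact absurd hkz (hlong _ ((frameLattice T).sub_mem ((frameLattice T).nsmul_mem hg k)
          (hT.intLattice_le hz)) h).not_gt
      obtain ⟨m, hm⟩ := Nat.dvd_factorial hk hkN
      rw [hm, mul_comm, mul_smul, sub_eq_zero.1 h0]
      exact (intLattice d).nsmul_mem hz m
    refine ⟨_, mk_mem_prod ?_ ?_, hP, T, hT, rfl⟩
    · exact fun g hg => ⟨by simpa using hg.2, hmul g hg.1⟩
    · exact fun g hg => ⟨hT.norm_le g hg.1, hmul g hg.2⟩
  · rintro P Q b ⟨hP, T, hT, rfl⟩ ⟨hQ, T', hT', hb⟩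
    obtain ⟨h1, h2⟩ := Prod.mk.inj hb
    have hL : frameLattice T = frameLattice T' := le_antisymm
      (hT.frameLattice_le hT' (h1.subset.trans inter_subset_left))
      (hT'.frameLattice_le hT (h1.symm.subset.trans inter_subset_left))
    have hPQ : T ⁻¹' P = T' ⁻¹' Q := by
      rw [hT.preimage_eq_convexHull hP, hT'.preimage_eq_convexHull hQ, h2]
    refine ⟨T'.symm.trans T, fun x => ?_, ?_⟩
    · rw [AffineEquiv.trans_apply, ← hT.mem_frameLattice_iff, hL, hT'.mem_frameLattice_iff,
        T'.apply_symm_apply]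
    · ext x
      have h3 : T.symm x ∈ T ⁻¹' P ↔ T.symm x ∈ T' ⁻¹' Q := by rw [hPQ]
      rw [mem_preimage, T.apply_symm_apply] at h3
      rw [h3]
      constructor
      · intro h
        exact ⟨_, h, by simp⟩
      · rintro ⟨y, hy, rfl⟩
        simpa using hy

end Frames

section Nondirectional

variable {d : ℕ}

theorem interior_affineEquiv_preimage (T : (Fin d → ℝ) ≃ᵃ[ℝ] (Fin d → ℝ)) (S : Set (Fin d → ℝ)) :
    interior (T ⁻¹' S) = T ⁻¹' interior S :=
  ((AffineEquiv.toContinuousAffineEquiv T).toHomeomorph.preimage_interior S).symm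

theorem cylinder_affineEquiv_preimage (T : (Fin d → ℝ) ≃ᵃ[ℝ] (Fin d → ℝ)) (S : Set (Fin d → ℝ))
    (r : Fin d → ℝ) :
    cylinder (Submodule.span ℝ {r}) (T ⁻¹' S) =
      T ⁻¹' cylinder (Submodule.span ℝ {T.linear r}) S := by
  have h : ∀ x (t : ℝ), T (x + t • r) = T x + t • T.linear r := by
    intro x t
    rw [affineEquiv_apply_eq, affineEquiv_apply_eq T x, map_add, map_smul]
    abel
  ext x
  constructor
  · rintro ⟨v, hv, hx⟩
    obtain ⟨t, rfl⟩ := Submodule.mem_span_singleton.1 hv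
    rw [mem_preimage, h] at hx
    exact ⟨_, Submodule.smul_mem _ t (Submodule.mem_span_singleton_self _), hx⟩
  · rintro ⟨v, hv, hx⟩
    obtain ⟨t, rfl⟩ := Submodule.mem_span_singleton.1 hv
    rw [← h] at hx
    exact ⟨_, Submodule.smul_mem _ t (Submodule.mem_span_singleton_self _), hx⟩

theorem interior_convexHull_insert_zero_singles_nonempty (d : ℕ) :
    (interior (convexHull ℝ (insert (0 : Fin d → ℝ) (range fun i => Pi.single i 1)))).Nonempty := by
  rw [interior_convexHull_nonempty_iff_affineSpan_eq_top,
    AffineSubspace.affineSpan_eq_top_iff_vectorSpan_eq_top_of_nonempty ℝ _ _ (insert_nonempty _ _),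
    vectorSpan_eq_span_vsub_set_right ℝ (mem_insert _ _), eq_top_iff,
    ← (Pi.basisFun ℝ (Fin d)).span_eq]
  refine Submodule.span_mono ?_
  rintro _ ⟨i, rfl⟩
  exact ⟨Pi.single i 1, mem_insert_of_mem _ ⟨i, rfl⟩, by simp⟩

/-- The maximal lattice-free integral polyhedra that contain no line in an integral direction form
finitely many classes. -/
theorem finClass_memI_of_cylinder_ne (d : ℕ) :
    FinClass {P | MemI d P ∧ ∀ r ∈ intPts d, r ≠ 0 → cylinder (Submodule.span ℝ {r}) P ≠ P} := by
  by_contra h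
  have hex : ∀ n : ℕ, ∃ P, (MemI d P ∧ ∀ r ∈ intPts d, r ≠ 0 →
      cylinder (Submodule.span ℝ {r}) P ≠ P) ∧ ∃ T, IsFrame P T ∧
        ∃ g ∈ frameLattice T, g ≠ 0 ∧ ‖g‖ < 1 / ((n : ℝ) + 1) := by
    intro n
    by_contra! hn
    refine h ((finClass_of_forall_le_norm d (ε := 1 / ((n : ℝ) + 1)) (by positivity)).mono ?_)
    intro P hP
    have hb : Bornology.IsBounded P := by
      by_contra hb
      obtain ⟨r, hr, hr0, hrP⟩ := hP.1.exists_cylinder_eq_of_not_isBounded hb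
      exact hP.2 r hr hr0 hrP
    obtain ⟨T, hT⟩ := exists_isFrame hP.1.1.2.2.2 hP.1.1.2.1 hb
    exact ⟨hP.1.1.2.2.2, T, hT, hn P hP T hT⟩
  choose P hP T hT hshort using hex
  obtain ⟨n, r, hr, hr0, hfree⟩ := exists_latticeFree_cylinder (d := d)
    (L := fun n => frameLattice (T n)) (C := fun n => T n ⁻¹' P n) (R := 1)
    (fun n => (hT n).intLattice_le) (fun n => (hT n).preimage_eq_convexHull (hP n).1.1.2.2.2)
    (fun n => (hT n).norm_le)
    (fun n => convexHull_min (insert_subset (hT n).zero_mem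
      (range_subset_iff.2 (hT n).single_mem))
      ((hP n).1.1.2.2.2.convex.affine_preimage (T n : (Fin d → ℝ) →ᵃ[ℝ] (Fin d → ℝ))))
    (interior_convexHull_insert_zero_singles_nonempty d)
    (fun n => by
      rw [interior_affineEquiv_preimage, eq_empty_iff_forall_notMem]
      exact fun x hx => (hP n).1.1.2.2.1.subset ⟨hx.1, (hT n).mem_frameLattice_iff.1 hx.2⟩)
    hshort
  have hr' : (T n).linear r ∈ intPts d := (hT n).intLattice_le hr
  refine (hP n).2 _ hr' ((map_ne_zero_iff _ (T n).linear.injective).2 hr0)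
    ((hP n).1.cylinder_eq hr' ?_)
  rw [cylinder_affineEquiv_preimage, interior_affineEquiv_preimage] at hfree
  rw [eq_empty_iff_forall_notMem]
  rintro x ⟨hx, hxZ⟩
  have hmem : (T n).symm x ∈ T n ⁻¹' interior (cylinder (Submodule.span ℝ {(T n).linear r}) (P n)) ∩
      frameLattice (T n) :=
    ⟨by simpa using hx, (hT n).mem_frameLattice_iff.2 (by simpa using hxZ)⟩
  rwa [hfree] at hmem

end Nondirectional

section Directional

variable {m : ℕ}

theorem intCast_mulVec_mem_intPts {d : ℕ} (M : Matrix (Fin d) (Fin d) ℤ) {x : Fin d → ℝ}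
    (hx : x ∈ intPts d) : (M.map (Int.cast : ℤ → ℝ)).mulVec x ∈ intPts d := by
  obtain ⟨z, rfl⟩ := exists_intCast_eq hx
  exact fun i => ⟨M.mulVec z i, by simp [Matrix.mulVec, dotProduct]⟩

/-- A nonzero integral vector is a multiple of the first vector of some basis of `ℤ^(m+1)`. -/
theorem exists_linearEquiv_single_zero {r : Fin (m + 1) → ℝ} (hr : r ∈ intPts (m + 1))
    (hr0 : r ≠ 0) :
    ∃ ψ : (Fin (m + 1) → ℝ) ≃ₗ[ℝ] (Fin (m + 1) → ℝ),
      (∀ x, ψ x ∈ intPts (m + 1) ↔ x ∈ intPts (m + 1)) ∧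
        ∃ c : ℝ, ψ (Pi.single 0 1) = c • r := by
  obtain ⟨z, rfl⟩ := exists_intCast_eq hr
  have hz : z ≠ 0 := by
    rintro rfl
    exact hr0 (by ext; simp)
  obtain ⟨n, S⟩ := Submodule.smithNormalForm (Pi.basisFun ℤ (Fin (m + 1)))
    (Submodule.span ℤ {z})
  have hn : ∃ i : Fin n, True := by
    by_contra! hn
    have h1 := S.bN.sum_repr ⟨z, Submodule.mem_span_singleton_self z⟩
    rw [Finset.sum_eq_zero fun i _ => (hn i).elim] at h1
    exact hz (congrArg Subtype.val h1).symm
  obtain ⟨i, -⟩ := hn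
  let b := S.bM.reindex (Equiv.swap 0 (S.f i))
  have hb : b 0 = S.bM (S.f i) := by simp [b]
  obtain ⟨k, hk⟩ := Submodule.mem_span_singleton.1 (S.bN i).2
  rw [S.snf i, ← hb] at hk
  have ha : S.a i ≠ 0 := by
    intro ha
    have := S.snf i
    rw [ha, zero_smul] at this
    exact S.bN.ne_zero i (Subtype.ext this)
  set M : Matrix (Fin (m + 1)) (Fin (m + 1)) ℤ := (Pi.basisFun ℤ (Fin (m + 1))).toMatrix b with hM
  set M' : Matrix (Fin (m + 1)) (Fin (m + 1)) ℤ := b.toMatrix (Pi.basisFun ℤ (Fin (m + 1)))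
  have hcast : ∀ A B : Matrix (Fin (m + 1)) (Fin (m + 1)) ℤ, A * B = 1 →
      A.map (Int.cast : ℤ → ℝ) * B.map (Int.cast : ℤ → ℝ) = 1 := by
    intro A B h
    rw [← Matrix.map_one (Int.cast : ℤ → ℝ) Int.cast_zero Int.cast_one, ← h]
    exact (Matrix.map_mul (f := Int.castRingHom ℝ)).symm
  let ψ := Matrix.toLin'OfInv (hcast M' M (Module.Basis.toMatrix_mul_toMatrix_flip _ _))
    (hcast M M' (Module.Basis.toMatrix_mul_toMatrix_flip _ _))
  have hψ : ∀ x, ψ x = (M.map (Int.cast : ℤ → ℝ)).mulVec x := fun x => rfl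
  have hψ' : ∀ x, ψ.symm x = (M'.map (Int.cast : ℤ → ℝ)).mulVec x := fun x => rfl
  refine ⟨ψ, fun x => ⟨fun h => ?_, fun h => hψ x ▸ intCast_mulVec_mem_intPts M h⟩,
    (k : ℝ) / S.a i, ?_⟩
  · rw [← ψ.symm_apply_apply x, hψ']
    exact intCast_mulVec_mem_intPts M' h
  · have ha' : (S.a i : ℝ) ≠ 0 := by exact_mod_cast ha
    ext j
    have h1 : (k : ℝ) * z j = S.a i * b 0 j := by
      have := congrFun hk j
      simp only [Pi.smul_apply, smul_eq_mul] at this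
      exact_mod_cast this
    rw [hψ, Matrix.mulVec_single_one]
    simp only [Matrix.col_apply, Matrix.map_apply, Pi.smul_apply, smul_eq_mul, hM,
      Module.Basis.toMatrix_apply, Pi.basisFun_repr]
    field_simp
    linarith

theorem UnimodEquiv.preimage_tail {P Q : Set (Fin m → ℝ)} (h : UnimodEquiv P Q) :
    UnimodEquiv (LinearMap.funLeft ℝ ℝ Fin.succ ⁻¹' P : Set (Fin (m + 1) → ℝ))
      (LinearMap.funLeft ℝ ℝ Fin.succ ⁻¹' Q) := by
  obtain ⟨φ, hφ, rfl⟩ := h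
  let e := (Fin.consLinearEquiv ℝ (fun _ : Fin (m + 1) => ℝ)).toAffineEquiv
  let φ' := e.symm.trans (((AffineEquiv.refl ℝ ℝ).prodCongr φ).trans e)
  have h0 : ∀ x, φ' x 0 = x 0 := fun x => rfl
  have hs : ∀ x, LinearMap.funLeft ℝ ℝ Fin.succ (φ' x) = φ (LinearMap.funLeft ℝ ℝ Fin.succ x) :=
    fun x => rfl
  refine ⟨φ', fun x => ?_, ?_⟩
  · have h1 := hφ (LinearMap.funLeft ℝ ℝ Fin.succ x)
    rw [← hs] at h1
    have h2 : ∀ y : Fin (m + 1) → ℝ, y ∈ intPts (m + 1) ↔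
        (∃ z : ℤ, y 0 = z) ∧ LinearMap.funLeft ℝ ℝ Fin.succ y ∈ intPts m :=
      fun y => Fin.forall_fin_succ
    rw [h2, h2 x, h1, h0]
  · ext x
    constructor
    · rintro ⟨y, hy, hyx⟩
      refine ⟨φ'.symm x, ?_, by simp⟩
      have h1 : φ (LinearMap.funLeft ℝ ℝ Fin.succ (φ'.symm x)) = φ y := by
        rw [← hs, φ'.apply_symm_apply, hyx]
      rw [mem_preimage, φ.injective h1]
      exact hy
    · rintro ⟨y, hy, rfl⟩
      exact ⟨_, hy, (hs y).symm⟩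

/-- A maximal lattice-free integral polyhedron that contains a line in an integral direction
comes from one of smaller dimension. -/
theorem MemI.exists_unimodEquiv_preimage_tail {P : Set (Fin (m + 1) → ℝ)} (hP : MemI (m + 1) P)
    {r : Fin (m + 1) → ℝ} (hr : r ∈ intPts (m + 1)) (hr0 : r ≠ 0)
    (hrP : cylinder (Submodule.span ℝ {r}) P = P) :
    ∃ P', MemI m P' ∧ UnimodEquiv P (LinearMap.funLeft ℝ ℝ Fin.succ ⁻¹' P') := by
  obtain ⟨ψ, hψ, c, hc⟩ := exists_linearEquiv_single_zero hr hr0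
  let f : (Fin (m + 1) → ℝ) →ₗ[ℝ] (Fin m → ℝ) := LinearMap.funLeft ℝ ℝ Fin.succ ∘ₗ ψ.symm
  let s : (Fin m → ℝ) →ₗ[ℝ] (Fin (m + 1) → ℝ) :=
    ψ.toLinearMap ∘ₗ (Fin.consLinearEquiv ℝ (fun _ : Fin (m + 1) => ℝ)).toLinearMap ∘ₗ
      LinearMap.inr ℝ ℝ (Fin m → ℝ)
  have hfψ : ∀ x, f (ψ x) = fun i => x i.succ := fun x => by
    ext i
    simp [f, LinearMap.funLeft]
  have hs : ∀ y, s y = ψ (Fin.cons 0 y) := fun y => rfl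
  have hfs : ∀ y, f (s y) = y := fun y => by rw [hs, hfψ]; rfl
  have hker : ∀ x, x = s (f x) + (ψ.symm x 0) • ψ (Pi.single 0 1) := by
    intro x
    obtain ⟨y, rfl⟩ := ψ.surjective x
    rw [hs, hfψ, ← map_smul, ← map_add, ψ.symm_apply_apply]
    congr 1
    ext i
    refine Fin.cases ?_ (fun i => ?_) i <;> simp
  have hinv : ∀ x ∈ P, ∀ t : ℝ, x + t • ψ (Pi.single 0 1) ∈ P := by
    intro x hx t
    rw [← hrP] at hx ⊢
    rw [hc, smul_smul]
    exact cylinder_add_smul_mem hx _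
  have hPf : f ⁻¹' (s ⁻¹' P) = P := by
    ext x
    have h1 := hker x
    constructor
    · intro hx
      rw [h1]
      exact hinv _ hx _
    · intro hx
      have h2 := hinv x hx (-(ψ.symm x 0))
      have h3 : s (f x) = x + (-(ψ.symm x 0)) • ψ (Pi.single 0 1) := by
        nth_rw 2 [h1]
        module
      rw [mem_preimage, mem_preimage, h3]
      exact h2
  have hiff : ∀ S, LatFreeIntegral (m + 1) (f ⁻¹' S) ↔ LatFreeIntegral m S := fun S =>
    latFreeIntegral_preimage_iff hfs ((hψ _).2 (single_mem_intLattice 0))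
      (by rw [hfψ]; ext; simp) (fun x => ⟨_, hker x⟩)
      (fun x hx i => by
        obtain ⟨y, rfl⟩ := ψ.surjective x
        rw [hfψ]
        exact (hψ y).1 hx i.succ)
      (fun y hy => by
        rw [hs, hψ]
        exact fun i => Fin.cases ⟨0, by simp⟩ (fun i => by simpa using hy i) i)
  refine ⟨s ⁻¹' P, ⟨(hiff _).1 (hPf.symm ▸ hP.1), fun Q hQ hPQ => ?_⟩, ψ.toAffineEquiv, hψ, ?_⟩
  · have hsurj : Function.Surjective f := fun y => ⟨s y, hfs y⟩
    exact preimage_injective.2 hsurj (hPf.trans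
      (hP.2 _ ((hiff Q).2 hQ) (hPf.symm.subset.trans (preimage_mono hPQ))))
  · nth_rw 1 [← hPf]
    ext x
    constructor
    · intro hx
      exact ⟨ψ.symm x, hx, ψ.apply_symm_apply x⟩
    · rintro ⟨y, hy, rfl⟩
      change f (ψ y) ∈ s ⁻¹' P
      rw [hfψ]
      exact hy

theorem finClass_memI (d : ℕ) : FinClass {P | MemI d P} := by
  induction d with
  | zero =>
    refine (finClass_memI_of_cylinder_ne 0).mono fun P hP => ⟨hP, fun r _ hr0 => ?_⟩
    exact absurd (Subsingleton.elim r 0) hr0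
  | succ m ih =>
    obtain ⟨T, hT, hTm⟩ := ih
    have h : FinClass {P | MemI (m + 1) P ∧ ∃ r ∈ intPts (m + 1), r ≠ 0 ∧
        cylinder (Submodule.span ℝ {r}) P = P} := by
      refine ⟨_, hT.image fun Q => LinearMap.funLeft ℝ ℝ Fin.succ ⁻¹' Q, ?_⟩
      rintro P ⟨hP, r, hr, hr0, hrP⟩
      obtain ⟨P', hP', hPP'⟩ := hP.exists_unimodEquiv_preimage_tail hr hr0 hrP
      obtain ⟨Q, hQ, hPQ⟩ := hTm P' hP'
      exact ⟨_, mem_image_of_mem _ hQ, hPP'.trans hPQ.preimage_tail⟩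
    refine (h.union (finClass_memI_of_cylinder_ne (m + 1))).mono fun P hP => ?_
    by_cases hd : ∃ r ∈ intPts (m + 1), r ≠ 0 ∧ cylinder (Submodule.span ℝ {r}) P = P
    · exact Or.inl ⟨hP, hd⟩
    · push Not at hd
      exact Or.inr ⟨hP, hd⟩

end Directional

/-- Up to unimodular transformations, there are only finitely many maximal
lattice-free integral polyhedra in `ℝ^d`. -/
theorem finitely_many_maximal_latticefree_integral_polyhedra (d : ℕ) :
    ∃ (N : ℕ) (Ps : Fin N → Set (Fin d → ℝ)),
      (∀ j, MemI d (Ps j)) ∧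
      ∀ P : Set (Fin d → ℝ), MemI d P →
        ∃ (U : Matrix (Fin d) (Fin d) ℤ) (v : Fin d → ℤ) (j : Fin N),
          |U.det| = 1 ∧ P = affMap U (fun i => (v i : ℝ)) '' Ps j := by
  obtain ⟨N, Ps, hPs, h⟩ := (finClass_memI d).exists_fin
  refine ⟨N, Ps, hPs, fun P hP => ?_⟩
  obtain ⟨j, hj⟩ := h P hP
  obtain ⟨U, v, hU⟩ := hj.exists_matrix
  exact ⟨U, v, j, hU⟩
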